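/- arXiv:1110.1003 — 2 statements merged into one kernel-verified Lean document; each statement's English description precedes it below -/
import Mathlib

section
/- For every infinite cardinal k, the space B*(k) is densely homogeneous with respect to the space Q(k)^ω: for any two dense subsets Y₁, Y₂ of B*(k), each homeomorphic to Q(k)^ω, there is a homeomorphism of B*(k) onto itself carrying Y₁ onto Y₂. -/
open Topology Set Filter

universe u v

noncomputable section

/-- Strong zero-dimensionality (`Ind X = 0`): any two disjoint closed sets
can be separated by a clopen set. -/
def StronglyZeroDim (X : Type*) [TopologicalSpace X] : Prop :=
  ∀ A B : Set X, IsClosed A → IsClosed B → Disjoint A B →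
    ∃ U : Set X, IsClopen U ∧ A ⊆ U ∧ Disjoint B U

/-- The topological weight of a space: the least cardinality of a base. -/
def topWeight (X : Type u) [TopologicalSpace X] : Cardinal.{u} :=
  ⨅ B : {B : Set (Set X) // TopologicalSpace.IsTopologicalBasis B}, Cardinal.mk B.1

/-- The space has a base of cardinality `< k`. -/
def WeightLT (X : Type u) [TopologicalSpace X] (k : Cardinal.{u}) : Prop :=
  ∃ B : Set (Set X), TopologicalSpace.IsTopologicalBasis B ∧ Cardinal.mk B < k

/-- Every point has a neighborhood of weight `< k`. -/
def LocallyWeightLT (X : Type u) [TopologicalSpace X] (k : Cardinal.{u}) : Prop :=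
  ∀ x : X, ∃ s : Set X, s ∈ nhds x ∧ WeightLT ↥s k

/-- `X ∈ σLW(<k)`: `X` is a countable union of subspaces, each locally of weight `< k`. -/
def SigmaLW (X : Type u) [TopologicalSpace X] (k : Cardinal.{u}) : Prop :=
  ∃ S : ℕ → Set X, (⋃ n, S n) = Set.univ ∧ ∀ n, LocallyWeightLT ↥(S n) k

/-- A `G_δσ`-subset: a countable union of `G_δ`-sets. -/
def IsGdeltaSigma {Y : Type*} [TopologicalSpace Y] (s : Set Y) : Prop :=
  ∃ G : ℕ → Set Y, (∀ n, IsGδ (G n)) ∧ s = ⋃ n, G n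

/-- An `F_σ`-subset: a countable union of closed sets. -/
def IsFsigmaSet {Y : Type*} [TopologicalSpace Y] (s : Set Y) : Prop :=
  ∃ F : ℕ → Set Y, (∀ n, IsClosed (F n)) ∧ s = ⋃ n, F n

/-- An `F_σδ`-subset: a countable intersection of `F_σ`-sets. -/
def IsFsigmaDelta {Y : Type*} [TopologicalSpace Y] (s : Set Y) : Prop :=
  ∃ F : ℕ → Set Y, (∀ n, IsFsigmaSet (F n)) ∧ s = ⋂ n, F n

/-- An absolute `G_δσ`-set: a metrizable space whose image under every embedding
into a metrizable space is a countable union of `G_δ`-sets. -/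
def AbsGdeltaSigma (X : Type u) [TopologicalSpace X] : Prop :=
  TopologicalSpace.MetrizableSpace X ∧
    ∀ (Y : Type u) [TopologicalSpace Y] [TopologicalSpace.MetrizableSpace Y]
      (f : X → Y), Topology.IsEmbedding f → IsGdeltaSigma (Set.range f)

/-- An absolute `F_σδ`-set: a metrizable space whose image under every embedding
into a metrizable space is an `F_σδ`-set. -/
def AbsFsigmaDelta (X : Type u) [TopologicalSpace X] : Prop :=
  TopologicalSpace.MetrizableSpace X ∧
    ∀ (Y : Type u) [TopologicalSpace Y] [TopologicalSpace.MetrizableSpace Y]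
      (f : X → Y), Topology.IsEmbedding f → IsFsigmaDelta (Set.range f)

/-- `X ∈ σLW(<k) + 𝒢_δσ` : `X = A ∪ B` with `A ∈ σLW(<k)` and `B` an absolute
`G_δσ`-set. -/
def SLWplusGDS (X : Type u) [TopologicalSpace X] (k : Cardinal.{u}) : Prop :=
  ∃ A B : Set X, A ∪ B = Set.univ ∧ SigmaLW ↥A k ∧ AbsGdeltaSigma ↥B

/-- No nonempty open subspace is `σLW(<k) + 𝒢_δσ`. -/
def NowhereSLWplusGDS (X : Type u) [TopologicalSpace X] (k : Cardinal.{u}) : Prop :=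
  ∀ U : Set X, IsOpen U → U.Nonempty → ¬ SLWplusGDS ↥U k

/-- A space is of first category if it is meager in itself. -/
def FirstCategory (X : Type*) [TopologicalSpace X] : Prop :=
  IsMeagre (Set.univ : Set X)

/-- A Souslin (analytic) subset of a space:
`s = ⋃_{t ∈ ω^ω} ⋂_n F(t↾n)` for a family of closed sets indexed by finite tuples. -/
def IsSuslinIn {Y : Type*} [TopologicalSpace Y] (s : Set Y) : Prop :=
  ∃ F : List ℕ → Set Y, (∀ l, IsClosed (F l)) ∧
    s = ⋃ t : ℕ → ℕ, ⋂ n : ℕ, F (List.ofFn fun i : Fin n => t i)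

/-- An absolute Souslin space: metrizable, and Souslin in every completely metrizable
space into which it embeds. -/
def AbsSuslin (X : Type u) [TopologicalSpace X] : Prop :=
  TopologicalSpace.MetrizableSpace X ∧
    ∀ (Y : Type u) [MetricSpace Y] [CompleteSpace Y] (f : X → Y),
      Topology.IsEmbedding f → IsSuslinIn (Set.range f)

/-- An h-homogeneous space: every nonempty clopen subset is homeomorphic to the
whole space. -/
def HHomogeneous (X : Type*) [TopologicalSpace X] : Prop :=
  ∀ U : Set X, IsClopen U → U.Nonempty → Nonempty (↥U ≃ₜ X)

/-- A discrete family of sets: every point has a neighborhood meeting at most one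
member of the family. -/
def DiscreteFamily {X : Type*} [TopologicalSpace X] {ι : Type*} (f : ι → Set X) : Prop :=
  ∀ x : X, ∃ U ∈ nhds x, {i | (f i ∩ U).Nonempty}.Subsingleton

/-- A discrete space of cardinality `k`. -/
def DiscT (k : Cardinal.{u}) : Type u := k.out

instance (k : Cardinal.{u}) : TopologicalSpace (DiscT k) := ⊥
instance (k : Cardinal.{u}) : DiscreteTopology (DiscT k) := ⟨rfl⟩

/-- The Baire space `B(k) = k^ω`. -/
def BaireB (k : Cardinal.{u}) : Type u := ℕ → DiscT k

instance (k : Cardinal.{u}) : TopologicalSpace (BaireB k) :=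
  inferInstanceAs (TopologicalSpace (ℕ → DiscT k))

open Classical in
/-- The discrete factor of `B*(k)`: two points if `k = ℵ₀`, and `k` points otherwise. -/
def StarT (k : Cardinal.{u}) : Type u :=
  if k = Cardinal.aleph0 then ULift Bool else DiscT k

instance (k : Cardinal.{u}) : TopologicalSpace (StarT k) := ⊥
instance (k : Cardinal.{u}) : DiscreteTopology (StarT k) := ⟨rfl⟩

/-- `B*(k)`: the Cantor set `2^ω` if `k = ℵ₀`, and the Baire space `B(k)` if `k > ℵ₀`. -/
def BaireStar (k : Cardinal.{u}) : Type u := ℕ → StarT k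

instance (k : Cardinal.{u}) : TopologicalSpace (BaireStar k) :=
  inferInstanceAs (TopologicalSpace (ℕ → StarT k))

/-- A discrete space of cardinality `k` (for infinite `k`), with a distinguished basepoint. -/
def QBase (k : Cardinal.{u}) : Type u := DiscT k ⊕ PUnit.{u + 1}

instance (k : Cardinal.{u}) : TopologicalSpace (QBase k) := ⊥
instance (k : Cardinal.{u}) : DiscreteTopology (QBase k) := ⟨rfl⟩

/-- `Q(k)`: the σ-product of `ω` copies of a discrete space of cardinality `k`, i.e.
the subspace of the product consisting of the sequences eventually equal to the basepoint. -/
def Qk (k : Cardinal.{u}) : Type u :=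
  {x : ℕ → QBase k // ∀ᶠ n in Filter.atTop, x n = Sum.inr PUnit.unit}

instance (k : Cardinal.{u}) : TopologicalSpace (Qk k) :=
  inferInstanceAs (TopologicalSpace
    {x : ℕ → QBase k // ∀ᶠ n in Filter.atTop, x n = Sum.inr PUnit.unit})

/-- The countable power `Q(k)^ω`. -/
def QkOmega (k : Cardinal.{u}) : Type u := ℕ → Qk k

instance (k : Cardinal.{u}) : TopologicalSpace (QkOmega k) :=
  inferInstanceAs (TopologicalSpace (ℕ → Qk k))

/-- `Z` is homeomorphic to `Q(k)^ω`. -/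
def IsQkOmega (k : Cardinal.{u}) (Z : Type*) [TopologicalSpace Z] : Prop :=
  Nonempty (Z ≃ₜ QkOmega k)

/-- `Z` is homeomorphic to `A^{II}_k`, the complement in `B*(k)` of a dense copy of
`Q(k)^ω`. -/
def IsAII (k : Cardinal.{u}) (Z : Type*) [TopologicalSpace Z] : Prop :=
  ∃ A : Set (BaireStar k), Dense A ∧ IsQkOmega k ↥A ∧ Nonempty (Z ≃ₜ ↥(Aᶜ))

/-- `Z` is homeomorphic to `A^I_k = Q × A^{II}_k`. -/
def IsAI (k : Cardinal.{u}) (Z : Type*) [TopologicalSpace Z] : Prop :=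
  ∃ A : Set (BaireStar k), Dense A ∧ IsQkOmega k ↥A ∧ Nonempty (Z ≃ₜ (ℚ × ↥(Aᶜ)))

/-- `Z` is homeomorphic to `M^{II}_k`, the complement in `B*(k)` of a dense copy of
`A^I_k`. -/
def IsMII (k : Cardinal.{u}) (Z : Type*) [TopologicalSpace Z] : Prop :=
  ∃ Y : Set (BaireStar k), Dense Y ∧ IsAI k ↥Y ∧ Nonempty (Z ≃ₜ ↥(Yᶜ))

/-- `X ∈ 𝓕_σδ ∖ σLW(<k)`: `X` is homeomorphic to `F ∖ L` for some absolute
`F_σδ`-space `F` and some `L ⊆ F` with `L ∈ σLW(<k)`. -/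
def FsdMinusSLW (X : Type u) [TopologicalSpace X] (k : Cardinal.{u}) : Prop :=
  ∃ (F : TopCat.{u}) (L : Set F), AbsFsigmaDelta ↥F ∧ SigmaLW ↥L k ∧
    Nonempty (X ≃ₜ ↥(Lᶜ))

/-- No nonempty open subspace is in the class `𝓕_σδ ∖ σLW(<k)`. -/
def NowhereFsdMinusSLW (X : Type u) [TopologicalSpace X] (k : Cardinal.{u}) : Prop :=
  ∀ U : Set X, IsOpen U → U.Nonempty → ¬ FsdMinusSLW ↥U k

/-- A topologically complete (i.e. completely metrizable) space. -/
def CompletelyMetrizable (X : Type*) [t : TopologicalSpace X] : Prop :=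
  ∃ m : MetricSpace X, m.toUniformSpace.toTopologicalSpace = t ∧
    @CompleteSpace X m.toUniformSpace

end

set_option linter.unusedSectionVars false

set_option linter.unusedSectionVars false
namespace DH

/-- Two sequences agree below `n`. -/
def Agr {S : Type u} (n : ℕ) (x x' : ℕ → S) : Prop := ∀ i < n, x i = x' i

lemma Agr.refl {S : Type u} (n : ℕ) (x : ℕ → S) : Agr n x x := fun _ _ => rfl
lemma Agr.symm {S : Type u} {n : ℕ} {x y : ℕ → S} (h : Agr n x y) : Agr n y x :=
  fun i hi => (h i hi).symm
lemma Agr.trans {S : Type u} {n : ℕ} {x y z : ℕ → S} (h : Agr n x y) (h' : Agr n y z) :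
    Agr n x z := fun i hi => (h i hi).trans (h' i hi)
lemma Agr.mono {S : Type u} {n m : ℕ} {x y : ℕ → S} (h : Agr n x y) (hm : m ≤ n) : Agr m x y :=
  fun i hi => h i (lt_of_lt_of_le hi hm)

section basics
variable {S : Type u} [TopologicalSpace S] [DiscreteTopology S]

lemma agr_mem_nhds (n : ℕ) (x : ℕ → S) : {x' | Agr n x x'} ∈ 𝓝 x := by
  have : ∀ᶠ x' in 𝓝 x, ∀ i ∈ Set.Iio n, x i = x' i := by
    rw [Filter.eventually_all_finite (Set.finite_Iio n)]
    intro i _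
    have h : ContinuousAt (fun x' : ℕ → S => x' i) x := (continuous_apply i).continuousAt
    have := h (mem_nhds_discrete.2 (rfl : x i ∈ ({x i} : Set S)))
    filter_upwards [this] with x' hx'
    exact hx'
  exact this

lemma mem_nhds_iff_agr {x : ℕ → S} {O : Set (ℕ → S)} :
    O ∈ 𝓝 x ↔ ∃ n, ∀ x', Agr n x x' → x' ∈ O := by
  constructor
  · intro h
    obtain ⟨O', hO', ho, hx⟩ := mem_nhds_iff.1 h
    obtain ⟨I, w, hw, hI⟩ := isOpen_pi_iff.1 ho x hx
    refine ⟨I.sup id + 1, fun x' hx' => hO' (hI ?_)⟩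
    intro i hi
    have : i ≤ I.sup id := Finset.le_sup (f := id) hi
    rw [← hx' i (by omega)]
    exact (hw i hi).2
  · rintro ⟨n, hn⟩
    exact Filter.mem_of_superset (agr_mem_nhds n x) hn

lemma isOpen_agr (n : ℕ) (x : ℕ → S) : IsOpen {x' | Agr n x x'} := by
  rw [isOpen_iff_mem_nhds]
  intro y hy
  rw [mem_nhds_iff_agr]
  exact ⟨n, fun z hz => Agr.trans hy hz⟩

/-- Limits of sequences of homeomorphisms. -/
lemma limit_homeo (f : ℕ → (ℕ → S) ≃ₜ (ℕ → S))
    (h1 : ∀ n x, Agr n (f (n+1) x) (f n x))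
    (h2 : ∀ n x, Agr n ((f (n+1)).symm x) ((f n).symm x)) :
    ∃ F : (ℕ → S) ≃ₜ (ℕ → S), ∀ n x, Agr n (F x) (f n x) := by
  have key : ∀ g : ℕ → (ℕ → S) → (ℕ → S), (∀ n x, Agr n (g (n+1) x) (g n x)) →
      ∀ n m x, n ≤ m → Agr n (g m x) (g n x) := by
    intro g hg n m x hnm
    induction m, hnm using Nat.le_induction with
    | base => exact Agr.refl _ _
    | succ m hm ih => exact ((hg m x).mono hm).trans ih
  have main : ∀ g : ℕ → (ℕ → S) → (ℕ → S), (∀ n x, Agr n (g (n+1) x) (g n x)) →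
      (∀ n, Continuous (g n)) → ∃ G : (ℕ → S) → (ℕ → S), Continuous G ∧
        ∀ n x, Agr n (G x) (g n x) := by
    intro g hg hc
    refine ⟨fun x i => g (i+1) x i, ?_, ?_⟩
    · exact continuous_pi fun i => (continuous_apply i).comp (hc (i+1))
    · intro n x i hi
      exact (key g hg (i+1) n x hi i (by omega)).symm
  obtain ⟨F, hF, hF'⟩ := main (fun n => f n) h1 (fun n => (f n).continuous)
  obtain ⟨G, hG, hG'⟩ := main (fun n => (f n).symm) h2 (fun n => (f n).symm.continuous)
  have inv : ∀ (F G : (ℕ → S) → (ℕ → S)) (f g : ℕ → (ℕ → S) → (ℕ → S)), Continuous F →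
      (∀ n x, Agr n (F x) (f n x)) → (∀ n x, Agr n (G x) (g n x)) →
      (∀ n x, f n (g n x) = x) → ∀ x, F (G x) = x := by
    intro F G f g hF hf hg hfg x
    funext i
    obtain ⟨n, hn⟩ := mem_nhds_iff_agr.1 (hF.continuousAt (agr_mem_nhds (i+1) (F (G x))))
    have h1 := hn (g (max n (i+1)) x) ((hg (max n (i+1)) x).mono (le_max_left _ _))
    have h2 := (hf (max n (i+1)) (g (max n (i+1)) x)) i (by
      have := le_max_right n (i+1); omega)
    rw [hfg] at h2
    rw [← h2]
    exact h1 i (by omega)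
  refine ⟨⟨⟨F, G, ?_, ?_⟩, hF, hG⟩, hF'⟩
  · exact inv G F (fun n => (f n).symm) (fun n => f n) hG hG' hF' (fun n x => by simp)
  · exact inv F G (fun n => f n) (fun n => (f n).symm) hF hF' hG' (fun n x => by simp)

end basics

lemma glue_cont {A B : Type*} [TopologicalSpace A] [TopologicalSpace B] {I : Type*} (c : A → I)
    (d : B → I) (hc : IsLocallyConstant c)
    (e : ∀ i, {a // c a = i} ≃ₜ {b // d b = i}) :
    Continuous (fun a => (e (c a) ⟨a, rfl⟩ : B)) := by
  rw [continuous_iff_continuousAt]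
  intro a
  have ho : IsOpen {a' | c a' = c a} := hc.isOpen_fiber (c a)
  have : ContinuousOn (fun a => (e (c a) ⟨a, rfl⟩ : B)) {a' | c a' = c a} := by
    rw [continuousOn_iff_continuous_domRestrict]
    have h2 : Set.domRestrict {a' | c a' = c a} (fun a => (e (c a) ⟨a, rfl⟩ : B))
        = fun z => ((e (c a) z : {b // d b = c a}) : B) := by
      funext z
      obtain ⟨z, hz⟩ := z
      have hz' : c z = c a := hz
      have : ∀ i (h : c z = i), ((e (c z) ⟨z, rfl⟩ : {b // d b = c z}) : B)
          = (e i ⟨z, h⟩ : {b // d b = i}) := by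
        intro i h; subst h; rfl
      exact this _ hz'
    rw [h2]
    exact continuous_subtype_val.comp (e (c a)).continuous
  exact this.continuousAt (ho.mem_nhds rfl)

/-- Gluing homeomorphisms along clopen partitions. -/
lemma glue {A B : Type*} [TopologicalSpace A] [TopologicalSpace B] {I : Type*} (c : A → I)
    (d : B → I) (hc : IsLocallyConstant c) (hd : IsLocallyConstant d)
    (e : ∀ i, {a // c a = i} ≃ₜ {b // d b = i}) :
    ∃ F : A ≃ₜ B, ∀ a, F a = (e (c a) ⟨a, rfl⟩ : B) := by
  refine ⟨⟨⟨fun a => (e (c a) ⟨a, rfl⟩ : B), fun b => ((e (d b)).symm ⟨b, rfl⟩ : A), ?_, ?_⟩,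
    glue_cont c d hc e, ?_⟩, fun a => rfl⟩
  · intro a
    have : ∀ b i (h : d b = i), (((e (d b)).symm ⟨b, rfl⟩ : {a // c a = d b}) : A)
            = ((e i).symm ⟨b, h⟩ : {a // c a = i}) := by
          intro b i h; subst h; rfl
    have := this _ _ (e (c a) ⟨a, rfl⟩).2
    exact this.trans (by simp)
  · intro b
    have : ∀ a i (h : c a = i), (((e (c a)) ⟨a, rfl⟩ : {b // d b = c a}) : B)
            = ((e i) ⟨a, h⟩ : {b // d b = i}) := by
          intro b i h; subst h; rfl
    have := this _ _ ((e (d b)).symm ⟨b, rfl⟩).2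
    exact this.trans (by simp)
  · exact glue_cont d c hd (fun i => (e i).symm)

section homog
variable {S : Type u} [TopologicalSpace S] [DiscreteTopology S]

lemma cyl_homeo (n : ℕ) (x : ℕ → S) : Nonempty ({x' // Agr n x x'} ≃ₜ (ℕ → S)) := by
  classical
  refine ⟨⟨⟨fun x' i => x'.1 (n + i), fun y => ⟨fun i => if i < n then x i else y (i - n), ?_⟩,
    ?_, ?_⟩, ?_, ?_⟩⟩
  · intro i hi; simp [hi]
  · rintro ⟨x', hx'⟩
    ext i
    by_cases hi : i < n
    · simp [hi, hx' i hi]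
    · have : n + (i - n) = i := by omega
      simp [hi, this]
  · intro y; funext i; simp
  · exact continuous_pi fun i => (continuous_apply (n + i)).comp continuous_subtype_val
  · refine Continuous.subtype_mk (continuous_pi fun i => ?_) _
    by_cases hi : i < n
    · simpa [hi] using continuous_const
    · simpa [hi] using continuous_apply _

lemma succ_homeo : Nonempty ((ℕ → S) ≃ₜ S × (ℕ → S)) := by
  refine ⟨⟨⟨fun x => (x 0, fun i => x (i+1)), fun p i => Nat.casesOn i p.1 p.2, ?_, ?_⟩, ?_, ?_⟩⟩
  · intro x; funext i; cases i <;> rfl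
  · intro p; rfl
  · exact (continuous_apply 0).prodMk (continuous_pi fun i => continuous_apply _)
  · refine continuous_pi fun i => ?_
    cases i with
    | zero => exact continuous_fst
    | succ i => exact (continuous_apply i).comp continuous_snd

def discHomeo {A B : Type*} [TopologicalSpace A] [TopologicalSpace B] [DiscreteTopology A]
    [DiscreteTopology B] (e : A ≃ B) : A ≃ₜ B :=
  ⟨e, continuous_of_discreteTopology, continuous_of_discreteTopology⟩

lemma prod_homeo_inf [Infinite S] (J : Type u) [TopologicalSpace J] [DiscreteTopology J]
    [Nonempty J] (hJ : Cardinal.mk J ≤ Cardinal.mk S) : Nonempty (J × (ℕ → S) ≃ₜ (ℕ → S)) := by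
  obtain ⟨s⟩ := succ_homeo (S := S)
  have : Cardinal.mk (J × S) = Cardinal.mk S := by
    rw [Cardinal.mk_prod, Cardinal.lift_id, Cardinal.lift_id]
    exact Cardinal.mul_eq_right (Cardinal.aleph0_le_mk S) hJ (Cardinal.mk_ne_zero J)
  obtain ⟨e⟩ := Cardinal.eq.1 this
  exact ⟨((Homeomorph.refl J).prodCongr s).trans ((Homeomorph.prodAssoc J S (ℕ → S)).symm.trans
    (((discHomeo e).prodCongr (Homeomorph.refl _)).trans s.symm))⟩

lemma prod_homeo_fin (hS : Nonempty (S ≃ Bool)) (n : ℕ) :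
    Nonempty (Fin (n+1) × (ℕ → S) ≃ₜ (ℕ → S)) := by
  obtain ⟨e⟩ := hS
  obtain ⟨s⟩ := succ_homeo (S := S)
  have u1 : Fin 1 × (ℕ → S) ≃ₜ (ℕ → S) := Homeomorph.uniqueProd (Fin 1) (ℕ → S)
  have two : (ℕ → S) ⊕ (ℕ → S) ≃ₜ (ℕ → S) :=
    (Homeomorph.sumCongr u1.symm u1.symm).trans ((Homeomorph.sumProdDistrib).symm.trans
      (((discHomeo (finSumFinEquiv.trans (finTwoEquiv.trans e.symm))).prodCongr
        (Homeomorph.refl _)).trans s.symm))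
  induction n with
  | zero => exact ⟨u1⟩
  | succ n ih =>
    obtain ⟨h⟩ := ih
    exact ⟨((discHomeo finSumFinEquiv.symm).prodCongr (Homeomorph.refl _)).trans
      (Homeomorph.sumProdDistrib.trans ((Homeomorph.sumCongr h u1).trans two))⟩

lemma clopen_homeo (hS : Nonempty (S ≃ Bool) ∨ Infinite S) (U : Set (ℕ → S)) (hU : IsClopen U)
    (hne : U.Nonempty) : Nonempty (↥U ≃ₜ (ℕ → S)) := by
  classical
  have hex : ∀ x : U, ∃ n, ∀ x', Agr n x.1 x' → x' ∈ U := fun x =>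
    mem_nhds_iff_agr.1 (hU.isOpen.mem_nhds x.2)
  let n : U → ℕ := fun x => Nat.find (hex x)
  have hn : ∀ x : U, ∀ x', Agr (n x) x.1 x' → x' ∈ U := fun x => Nat.find_spec (hex x)
  have hloc : ∀ x y : U, Agr (n x) x.1 y.1 → n y = n x := by
    intro x y hxy
    apply le_antisymm
    · exact Nat.find_min' (hex y) (fun z hz => hn x z (hxy.trans hz))
    · by_contra! hlt
      have h3 : n x ≤ n y := Nat.find_min' (hex x) (m := n y) (fun z hz => hn y z
        (((hxy.mono hlt.le).symm).trans hz))
      omega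
  let c : U → (Σ m : ℕ, (Fin m → S)) := fun x => ⟨n x, fun i => x.1 i⟩
  have hcc : ∀ x y : U, c y = c x ↔ Agr (n x) x.1 y.1 := by
    intro x y
    constructor
    · intro h
      simp only [c, Sigma.mk.injEq] at h
      obtain ⟨h1, h2⟩ := h
      have : ∀ (m m' : ℕ) (_ : m' = m), ((fun i : Fin m' => y.1 i) ≍ (fun i : Fin m => x.1 i)) →
          Agr m x.1 y.1 := by
        intro m m' h h'
        subst h
        intro i hi
        exact (congrFun (eq_of_heq h') ⟨i, hi⟩).symm
      exact this _ _ h1 h2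
    · intro h
      have h1 := hloc x y h
      have : ∀ m m' (_ : m' = m) (_ : Agr m x.1 y.1), (⟨m', fun i => y.1 i⟩ : Σ m : ℕ, (Fin m → S))
          = ⟨m, fun i => x.1 i⟩ := by
        intro m m' h h'
        subst h
        congr
        funext i
        exact (h' i i.2).symm
      exact this _ _ h1 h
  let J := Set.range c
  let _ : TopologicalSpace J := ⊥
  have : DiscreteTopology J := ⟨rfl⟩
  let c' : U → J := fun x => ⟨c x, x, rfl⟩
  have hc' : IsLocallyConstant c' := by
    rw [IsLocallyConstant.iff_eventually_eq]
    intro x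
    have := (continuous_subtype_val (p := fun z => z ∈ U)).continuousAt
      (x := x) (agr_mem_nhds (n x) x.1)
    filter_upwards [this] with y hy
    exact Subtype.ext ((hcc x y).2 hy)
  let d : J × (ℕ → S) → J := Prod.fst
  have hd : IsLocallyConstant d := (IsLocallyConstant.iff_continuous d).2 continuous_fst
  have hfib : ∀ j : J, Nonempty ({a // c' a = j} ≃ₜ {b // d b = j}) := by
    rintro ⟨_, x, rfl⟩
    obtain ⟨e⟩ := cyl_homeo (n x) x.1
    have e1 : {a // c' a = ⟨c x, x, rfl⟩} ≃ₜ {x' // Agr (n x) x.1 x'} :=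
      ⟨⟨fun a => ⟨a.1.1, (hcc _ _).1 (congrArg Subtype.val a.2)⟩,
        fun a => ⟨⟨a.1, hn x _ a.2⟩, Subtype.ext ((hcc x ⟨a.1, hn x _ a.2⟩).2 a.2)⟩,
        fun a => rfl, fun a => rfl⟩, by fun_prop, by fun_prop⟩
    have e2 : {b // d b = ⟨c x, x, rfl⟩} ≃ₜ (ℕ → S) :=
      ⟨⟨fun b => b.1.2, fun y => ⟨(⟨c x, x, rfl⟩, y), rfl⟩, by
        rintro ⟨⟨j, y⟩, h⟩
        have : j = ⟨c x, x, rfl⟩ := h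
        subst this
        rfl, fun y => rfl⟩, by fun_prop, by fun_prop⟩
    exact ⟨e1.trans (e.trans e2.symm)⟩
  obtain ⟨F, -⟩ := glue c' d hc' hd (fun j => (hfib j).some)
  have : Nonempty J := ⟨c' ⟨_, hne.choose_spec⟩⟩
  rcases hS with hS | hS
  · have : Finite S := Finite.of_equiv _ hS.some.symm
    have : CompactSpace U := isCompact_iff_compactSpace.1 hU.isClosed.isCompact
    have : CompactSpace (J × (ℕ → S)) := F.compactSpace
    have : Nonempty S := ⟨hS.some.symm true⟩
    have : CompactSpace J := Function.Surjective.compactSpace (f := (Prod.fst : J × (ℕ → S) → J))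
      continuous_fst Prod.fst_surjective
    have : Finite J := finite_of_compact_of_discrete
    obtain ⟨m, ⟨e⟩⟩ := Finite.exists_equiv_fin J
    cases m with
    | zero => exact (Fin.elim0 (e (Classical.arbitrary J)))
    | succ m =>
      obtain ⟨h⟩ := prod_homeo_fin hS m
      exact ⟨F.trans (((discHomeo e).prodCongr (Homeomorph.refl _)).trans h)⟩
  · have hJ : Cardinal.mk J ≤ Cardinal.mk S := by
      refine (Cardinal.mk_set_le J).trans ?_
      rw [Cardinal.mk_sigma]
      refine (Cardinal.sum_le_sum _ (fun _ => Cardinal.mk S) ?_).trans ?_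
      · intro m
        rw [Cardinal.mk_arrow, Cardinal.mk_fin]
        simp only [Cardinal.lift_natCast, Cardinal.lift_uzero]
        exact Cardinal.power_nat_le (Cardinal.aleph0_le_mk S)
      · rw [Cardinal.sum_const]
        simp [Cardinal.aleph0_le_mk S]
    obtain ⟨h⟩ := prod_homeo_inf (S := S) J hJ
    exact ⟨F.trans h⟩

end homog
end DH

namespace DH
section comb
variable {S : Type u} [TopologicalSpace S] [DiscreteTopology S]

/-- The first `n` entries of a sequence. -/
def pr (n : ℕ) (x : ℕ → S) : List S := List.ofFn (fun i : Fin n => x i)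

lemma pr_eq {n : ℕ} {x y : ℕ → S} : pr n x = pr n y ↔ Agr n x y := by
  unfold pr
  rw [List.ofFn_inj]
  constructor
  · intro h i hi
    exact congrFun h ⟨i, hi⟩
  · intro h
    funext i
    exact h i i.2

lemma pr_loc (n : ℕ) : IsLocallyConstant (pr n : (ℕ → S) → List S) := by
  rw [IsLocallyConstant.iff_eventually_eq]
  intro x
  filter_upwards [agr_mem_nhds n x] with y hy
  exact (pr_eq.2 hy).symm

/-- Every relatively open piece of `D` has at least `#K` many separated points. -/
def Spread (K : Type u) (D : Set (ℕ → S)) : Prop :=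
  ∀ x ∈ D, ∀ n, ∃ (A : K → (ℕ → S)) (m : K → ℕ), (∀ a, A a ∈ D ∧ Agr n x (A a)) ∧
    ∀ a a', Agr (m a) (A a) (A a') → a = a'

open Cardinal in
lemma spread_card {K : Type u} {D : Set (ℕ → S)} (hD : Spread K D) (x : ℕ → S) (hx : x ∈ D)
    (n : ℕ) : #K ≤ Cardinal.sum (fun m => #(pr m '' (D ∩ {z | Agr n x z}))) := by
  obtain ⟨A, m, h1, h2⟩ := hD x hx n
  rw [← Cardinal.mk_sigma]
  refine Cardinal.mk_le_of_injective
    (f := fun a => ⟨m a, ⟨pr (m a) (A a), A a, h1 a, rfl⟩⟩) ?_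
  intro a a' h
  simp only [Sigma.mk.injEq] at h
  obtain ⟨h3, h4⟩ := h
  apply h2
  have : ∀ k k' (_ : k = k') (p : (pr k '' (D ∩ {z | Agr n x z}) : Set (List S)))
    (p' : (pr k' '' (D ∩ {z | Agr n x z}) : Set (List S))), p ≍ p' → p.1 = p'.1 := by
    intro k k' h p p' hp
    subst h
    rw [eq_of_heq hp]
  have h5 := this _ _ h3 _ _ h4
  simp only at h5
  rw [← h3] at h5
  exact pr_eq.1 h5

open Cardinal in
lemma comb_big {K : Type u} {D : Set (ℕ → S)} (hD : Spread K D) (hne : D.Nonempty)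
    (hK : ℵ₀ < #K) : ∃ q : (ℕ → S) → List S × List S, IsLocallyConstant q ∧ #K ≤ #(q '' D) := by
  classical
  obtain ⟨x0, hx0⟩ := hne
  have hsum : ∀ (g : ℕ → Cardinal.{u}) (μ : Cardinal.{u}), μ < #K → (∀ n, g n ≤ μ) →
      ¬ #K ≤ Cardinal.sum g := by
    intro g μ hμ hg h
    have h1 : Cardinal.sum g ≤ ℵ₀ * μ := by
      refine (Cardinal.sum_le_sum g (fun _ => μ) hg).trans ?_
      simp [Cardinal.sum_const]
    have h2 : ℵ₀ * μ < #K := Cardinal.mul_lt_of_lt hK.le hK hμ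
    exact absurd (h.trans h1) (not_le.2 h2)
  have huniv : ∀ x : ℕ → S, D ∩ {z | Agr 0 x z} = D := by
    intro x
    ext z
    simp [Agr]
  have htot := spread_card hD x0 hx0 0
  rw [huniv] at htot
  by_cases hbig : ∃ n, #K ≤ #(pr n '' D)
  · obtain ⟨n, hn⟩ := hbig
    refine ⟨fun x => (pr n x, []), (pr_loc n).comp (fun l => (l, [])), hn.trans ?_⟩
    refine Cardinal.mk_le_of_injective (f := fun l => ⟨(l.1, []), ?_⟩) ?_
    · obtain ⟨l, x, hx, rfl⟩ := l
      exact ⟨x, hx, rfl⟩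
    · intro l l' h
      simp only [Subtype.mk.injEq, Prod.mk.injEq, and_true] at h
      exact Subtype.ext h
  push Not at hbig
  have hinf : ∃ n, ℵ₀ ≤ #(pr n '' D) := by
    by_contra! hcon
    exact hsum _ ℵ₀ hK (fun n => (hcon n).le) htot
  obtain ⟨n0, hn0⟩ := hinf
  obtain ⟨t, ht⟩ : ∃ t : ℕ → (pr n0 '' D : Set (List S)), Function.Injective t := by
    have : Infinite (pr n0 '' D : Set (List S)) := Cardinal.infinite_iff.2 hn0
    exact ⟨_, (Infinite.natEmbedding _).injective⟩
  choose p hpD hpt using fun i => (t i).2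
  have hlev : ∀ i, ∃ m, #(pr i '' D) ≤ #(pr m '' (D ∩ {z | Agr n0 (p i) z})) := by
    intro i
    by_contra! hcon
    exact hsum _ _ (hbig i) (fun m => (hcon m).le) (spread_card hD (p i) (hpD i) n0)
  choose m hm using hlev
  have hpp : ∀ i j, Agr n0 (p i) (p j) → i = j := by
    intro i j h
    apply ht
    apply Subtype.ext
    rw [← hpt i, ← hpt j]
    exact pr_eq.2 h
  let q : (ℕ → S) → List S × List S := fun x =>
    (pr n0 x, if h : ∃ i, Agr n0 (p i) x then pr (m h.choose) x else [])
  have hq : ∀ i x, Agr n0 (p i) x → q x = (pr n0 (p i), pr (m i) x) := by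
    intro i x hx
    have hex : ∃ i, Agr n0 (p i) x := ⟨i, hx⟩
    have : hex.choose = i := hpp _ _ (hex.choose_spec.trans hx.symm)
    simp only [q, dif_pos hex, this]
    rw [pr_eq.2 hx]
  refine ⟨q, ?_, ?_⟩
  · rw [IsLocallyConstant.iff_eventually_eq]
    intro x
    by_cases h : ∃ i, Agr n0 (p i) x
    · obtain ⟨i, hi⟩ := h
      filter_upwards [agr_mem_nhds (max n0 (m i)) x] with y hy
      rw [hq i x hi, hq i y (hi.trans (hy.mono (le_max_left _ _))),
        pr_eq.2 (hy.mono (le_max_right _ _))]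
    · filter_upwards [agr_mem_nhds n0 x] with y hy
      have h' : ¬ ∃ i, Agr n0 (p i) y := fun ⟨i, hi⟩ => h ⟨i, hi.trans hy.symm⟩
      simp only [q, dif_neg h, dif_neg h']
      rw [pr_eq.2 hy]
  · refine htot.trans ((Cardinal.sum_le_sum _ _ hm).trans ?_)
    rw [← Cardinal.mk_sigma]
    refine Cardinal.mk_le_of_injective (f := fun l => ⟨(pr n0 (p l.1), l.2.1), ?_⟩) ?_
    · obtain ⟨i, l, x, hx, rfl⟩ := l
      exact ⟨x, hx.1, hq i x hx.2⟩
    · rintro ⟨i, l⟩ ⟨j, l'⟩ h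
      simp only [Subtype.mk.injEq, Prod.mk.injEq] at h
      have hij := hpp i j (pr_eq.1 h.1)
      subst hij
      congr 1
      exact Subtype.ext h.2

lemma sep_fin {J : Type*} [Finite J] (v : J → (ℕ → S)) (hv : Function.Injective v) :
    ∃ n, Function.Injective (fun j => pr n (v j)) := by
  classical
  have := Fintype.ofFinite J
  have : ∀ p : J × J, ∃ n, p.1 ≠ p.2 → ¬ Agr n (v p.1) (v p.2) := by
    intro p
    by_cases h : p.1 = p.2
    · exact ⟨0, fun h' => absurd h h'⟩
    · have : v p.1 ≠ v p.2 := fun h' => h (hv h')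
      obtain ⟨i, hi⟩ := Function.ne_iff.1 this
      exact ⟨i+1, fun _ h' => hi (h' i (by omega))⟩
  choose N hN using this
  refine ⟨Finset.univ.sup N, fun a b hab => ?_⟩
  by_contra hne
  exact hN (a, b) hne ((pr_eq.1 hab).mono (Finset.le_sup (Finset.mem_univ _)))

open Cardinal in
lemma comb {K : Type u} {D : Set (ℕ → S)} (hD : Spread K D) (hne : D.Nonempty) (J : Type u)
    (hJ : (Infinite K ∧ Finite J) ∨ (ℵ₀ < #K ∧ #J ≤ #K)) :
    ∃ (q : (ℕ → S) → List S × List S) (v : J → (ℕ → S)), IsLocallyConstant q ∧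
      (∀ j, v j ∈ D) ∧ Function.Injective (fun j => q (v j)) := by
  rcases hJ with ⟨hK, hJ⟩ | ⟨hK, hJ⟩
  · obtain ⟨x0, hx0⟩ := hne
    obtain ⟨A, m, h1, h2⟩ := hD x0 hx0 0
    obtain ⟨N, ⟨e⟩⟩ := Finite.exists_equiv_fin J
    let v : J → (ℕ → S) := fun j => A (Infinite.natEmbedding K (e j))
    have hv : Function.Injective v := by
      intro a b hab
      have := h2 _ _ (show Agr (m (Infinite.natEmbedding K (e a))) (v a) (v b) by
        rw [hab]; exact Agr.refl _ _)
      exact e.injective (Fin.ext ((Infinite.natEmbedding K).injective this))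
    obtain ⟨n, hn⟩ := sep_fin v hv
    refine ⟨fun x => (pr n x, []), v, (pr_loc n).comp (fun l => (l, [])), fun j => (h1 _).1, ?_⟩
    intro a b hab
    exact hn (Prod.mk.inj hab).1
  · obtain ⟨q, hq, hc⟩ := comb_big hD hne hK
    obtain ⟨e⟩ := Cardinal.le_def J (q '' D) |>.1 (hJ.trans hc)
    choose v hvD hvq using fun j => (e j).2
    refine ⟨q, v, hq, hvD, fun a b hab => e.injective (Subtype.ext ?_)⟩
    rw [← hvq a, ← hvq b]
    exact hab

end comb
end DH

namespace DH
section good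
variable {S : Type u} [TopologicalSpace S] [DiscreteTopology S] {K : Type u}

/-- Every row is eventually equal to the basepoint. -/
def Fin0 (o : K) (z : ℕ → ℕ → K) : Prop := ∀ i, ∃ N, ∀ j ≥ N, z i j = o

/-- Agreement on the block `N × N`. -/
def Blk (N : ℕ) (z z' : ℕ → ℕ → K) : Prop := ∀ i < N, ∀ j < N, z i j = z' i j

structure GoodBy (o : K) (Y : Set (ℕ → S)) (h : (ℕ → S) → ℕ → ℕ → K) : Prop where
  dense : Dense Y
  fin : ∀ y ∈ Y, Fin0 o (h y)
  cont : ∀ y ∈ Y, ∀ i j, ∀ᶠ y' in 𝓝 y, y' ∈ Y → h y' i j = h y i j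
  opn : ∀ y ∈ Y, ∀ O ∈ 𝓝 y, ∃ N, ∀ z, Fin0 o z → Blk N (h y) z → ∃ y' ∈ Y, y' ∈ O ∧ h y' = z
  inj : ∀ y ∈ Y, ∀ y' ∈ Y, h y = h y' → y = y'

lemma GoodBy.comap {o : K} {Y : Set (ℕ → S)} {h : (ℕ → S) → ℕ → ℕ → K} (hG : GoodBy o Y h)
    (j : (ℕ → S) → (ℕ → S)) (hj : IsOpenEmbedding j) : GoodBy o (j ⁻¹' Y) (fun x => h (j x)) where
  dense := hG.dense.preimage hj.isOpenMap
  fin := fun y hy => hG.fin _ hy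
  cont := fun y hy a b => hj.continuous.continuousAt.eventually (hG.cont _ hy a b)
  opn := by
    intro y hy O hO
    obtain ⟨N, hN⟩ := hG.opn (j y) hy (j '' O) (hj.isOpenMap.image_mem_nhds hO)
    refine ⟨N, fun z hz hb => ?_⟩
    obtain ⟨y', hy', ⟨x, hx, rfl⟩, h2⟩ := hN z hz hb
    exact ⟨x, hy', hx, h2⟩
  inj := fun y hy y' hy' hh => hj.injective (hG.inj _ hy _ hy' hh)

def FSD (C : Set (ℕ → S)) : Prop :=
  ∃ F : ℕ → ℕ → Set (ℕ → S), (∀ i m, IsClosed (F i m)) ∧ ∀ x, x ∈ C ↔ ∀ i, ∃ m, x ∈ F i m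

lemma FSD.comap {C : Set (ℕ → S)} (hC : FSD C) (j : (ℕ → S) → (ℕ → S)) (hj : Continuous j) :
    FSD (j ⁻¹' C) := by
  obtain ⟨F, h1, h2⟩ := hC
  exact ⟨fun i m => j ⁻¹' F i m, fun i m => (h1 i m).preimage hj, fun x => h2 (j x)⟩

lemma FSD.bits {C : Set (ℕ → S)} (hC : FSD C) : ∃ b : (ℕ → S) → ℕ → ℕ → Bool,
    (∀ x x' i n, Agr n x x' → b x i n = b x' i n) ∧
    ∀ x, x ∈ C ↔ ∀ i, ∃ N, ∀ n ≥ N, b x i n = false := by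
  classical
  obtain ⟨F, h1, h2⟩ := hC
  have hex : ∀ (x : ℕ → S) (i n : ℕ), ∃ m, n ≤ m ∨ ∃ x', Agr n x x' ∧ x' ∈ F i m :=
    fun x i n => ⟨n, Or.inl le_rfl⟩
  let r : (ℕ → S) → ℕ → ℕ → ℕ := fun x i n => Nat.find (hex x i n)
  have hr : ∀ x i n, n ≤ r x i n ∨ ∃ x', Agr n x x' ∧ x' ∈ F i (r x i n) := fun x i n =>
    Nat.find_spec (hex x i n)
  have hmin : ∀ x i n m, (n ≤ m ∨ ∃ x', Agr n x x' ∧ x' ∈ F i m) → r x i n ≤ m :=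
    fun x i n m hm => Nat.find_min' (hex x i n) hm
  have hmono : ∀ x i n m, m ≤ n → r x i m ≤ r x i n := by
    intro x i n m hmn
    apply hmin
    rcases hr x i n with h | ⟨x', h, h'⟩
    · exact Or.inl (hmn.trans h)
    · exact Or.inr ⟨x', h.mono hmn, h'⟩
  have hloc : ∀ x x' i n, Agr n x x' → r x i n ≤ r x' i n := by
    intro x x' i n hx
    apply hmin
    rcases hr x' i n with h | ⟨z, h, h'⟩
    · exact Or.inl h
    · exact Or.inr ⟨z, hx.trans h, h'⟩
  have hloc' : ∀ x x' i n, Agr n x x' → r x i n = r x' i n := fun x x' i n hx =>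
    le_antisymm (hloc _ _ _ _ hx) (hloc _ _ _ _ hx.symm)
  refine ⟨fun x i n => decide (r x i n ≠ r x i (n-1)), ?_, ?_⟩
  · intro x x' i n hx
    simp only [hloc' x x' i n hx, hloc' x x' i (n-1) (hx.mono (by omega))]
  · intro x
    rw [h2]
    refine forall_congr' fun i => ?_
    simp only [decide_eq_false_iff_not, not_not]
    constructor
    · rintro ⟨m, hm⟩
      have hb : ∀ n, r x i n ≤ m := fun n => hmin x i n m (Or.inr ⟨x, Agr.refl _ _, hm⟩)
      obtain ⟨N, hN⟩ := WellFoundedGT.monotone_chain_condition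
        (α := Fin (m+1)) ⟨fun n => (⟨r x i n, by have := hb n; omega⟩ : Fin (m+1)),
          fun a c hac => hmono x i c a hac⟩
      refine ⟨N+1, fun n hn => ?_⟩
      have e1 := congrArg Fin.val (hN n (by omega))
      have e2 := congrArg Fin.val (hN (n-1) (by omega))
      change r x i N = r x i n at e1
      change r x i N = r x i (n-1) at e2
      omega
    · rintro ⟨N, hN⟩
      have hc : ∀ n, N ≤ n → r x i n = r x i N := by
        intro n hn
        induction n, hn using Nat.le_induction with
        | base => rfl
        | succ n hn ih => rw [hN (n+1) (by omega)]; exact ih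
      refine ⟨r x i N, ?_⟩
      rw [← (h1 i (r x i N)).closure_eq, mem_closure_iff_nhds]
      intro O hO
      obtain ⟨m, hm⟩ := mem_nhds_iff_agr.1 hO
      let n := max (max N m) (r x i N + 1)
      have h3 := hr x i n
      rw [hc n ((le_max_left _ _).trans (le_max_left _ _))] at h3
      rcases h3 with h3 | ⟨x', h3, h4⟩
      · have : r x i N + 1 ≤ n := le_max_right _ _
        omega
      · exact ⟨x', hm _ (h3.mono ((le_max_right _ _).trans (le_max_left _ _))), h4⟩

lemma good_spread {o : K} {Y : Set (ℕ → S)} {h : (ℕ → S) → ℕ → ℕ → K} (hG : GoodBy o Y h)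
    (y : ℕ → S) (V : Set (ℕ → S)) (hV : IsOpen V) (n N : ℕ) :
    Spread K {v | v ∈ V ∧ v ∈ Y ∧ (∀ i < n, h v i = h y i) ∧ Blk N (h y) (h v)} := by
  classical
  rintro v ⟨hvV, hvY, hvr, hvb⟩ n'
  obtain ⟨N1, hN1⟩ := hG.opn v hvY (V ∩ {z | Agr n' v z})
    (Filter.inter_mem (hV.mem_nhds hvV) (agr_mem_nhds n' v))
  let M := max (max n N) N1
  have hMn : n ≤ M := (le_max_left _ _).trans (le_max_left _ _)
  have hMN : N ≤ M := (le_max_right _ _).trans (le_max_left _ _)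
  have hMN1 : N1 ≤ M := le_max_right _ _
  let z : K → ℕ → ℕ → K := fun a i j => if i = M ∧ j = M then a else h v i j
  have hz : ∀ a i j, i ≠ M → z a i j = h v i j := by
    intro a i j hi
    simp [z, hi]
  have hzf : ∀ a, Fin0 o (z a) := by
    intro a i
    obtain ⟨L, hL⟩ := hG.fin v hvY i
    refine ⟨max L (M+1), fun j hj => ?_⟩
    have h1 := le_max_left L (M+1)
    have h2 := le_max_right L (M+1)
    have : ¬ (i = M ∧ j = M) := by omega
    simp only [z, if_neg this]
    exact hL j (by omega)
  choose A hA1 hA2 hA3 using fun a => hN1 (z a) (hzf a) (fun i hi j hj => (hz a i j (by omega)).symm)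
  choose m hm using fun a => mem_nhds_iff_agr.1 (hG.cont (A a) (hA1 a) M M)
  refine ⟨A, m, fun a => ⟨⟨(hA2 a).1, hA1 a, ?_, ?_⟩, (hA2 a).2⟩, ?_⟩
  · intro i hi
    rw [hA3, ← hvr i hi]
    funext j
    exact hz a i j (by omega)
  · intro i hi j hj
    rw [hA3, hz a i j (by omega)]
    exact hvb i hi j hj
  · intro a a' haa
    have := hm a (A a') haa (hA1 a')
    rw [hA3, hA3] at this
    simpa [z] using this.symm

/-- The step relation between successive base points. -/
def Rel (o : K) (h : (ℕ → S) → ℕ → ℕ → K) (n N0 : ℕ) (β : ℕ → Bool) (y y' : ℕ → S) : Prop :=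
  (∀ i < n, β i = false → h y' i = h y i) ∧
  (∀ i < n, β i = true → ∃ M ≥ n, h y' i M ≠ o) ∧
  (∀ i < n, ∀ M, h y i M ≠ o → h y' i M = h y i M) ∧
  Blk (n + N0) (h y) (h y')

lemma exists_rel {o ν : K} (hν : ν ≠ o) {Y : Set (ℕ → S)} {h : (ℕ → S) → ℕ → ℕ → K}
    (hG : GoodBy o Y h) (y : ℕ → S) (n N0 : ℕ) (β : ℕ → Bool) (v : ℕ → S) (hv : v ∈ Y)
    (hr : ∀ i < n, h v i = h y i) (hb : Blk (n + N0) (h y) (h v)) (O : Set (ℕ → S))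
    (hO : O ∈ 𝓝 v) : ∃ y' ∈ Y, y' ∈ O ∧ Rel o h n N0 β y y' := by
  classical
  obtain ⟨N1, hN1⟩ := hG.opn v hv O hO
  choose L hL using hG.fin v hv
  let M := (Finset.range n).sup L + N1 + n + N0
  have hLM : ∀ i < n, L i ≤ M := by
    intro i hi
    have : L i ≤ (Finset.range n).sup L := Finset.le_sup (Finset.mem_range.2 hi)
    omega
  let z : ℕ → ℕ → K := fun i j => if i < n ∧ β i = true ∧ j = M then ν else h v i j
  have hzf : Fin0 o z := by
    intro i
    refine ⟨max (L i) (M+1), fun j hj => ?_⟩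
    have h1 := le_max_left (L i) (M+1)
    have h2 := le_max_right (L i) (M+1)
    have : ¬ (i < n ∧ β i = true ∧ j = M) := by
      rintro ⟨_, _, h3⟩
      omega
    simp only [z, if_neg this]
    exact hL i j (by omega)
  have hz : ∀ i j, j ≠ M → z i j = h v i j := by
    intro i j hj
    simp [z, hj]
  obtain ⟨y', hy', hy'O, hy'z⟩ := hN1 z hzf (fun i hi j hj => (hz i j (by omega)).symm)
  refine ⟨y', hy', hy'O, ?_, ?_, ?_, ?_⟩
  · intro i hi hβ
    rw [hy'z, ← hr i hi]
    funext j
    simp [z, hβ]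
  · intro i hi hβ
    refine ⟨M, by omega, ?_⟩
    rw [hy'z]
    simpa [z, hβ, hi] using hν
  · intro i hi j hj
    rw [← hr i hi] at hj ⊢
    rw [hy'z]
    apply hz
    rintro rfl
    exact hj (hL i _ (hLM i hi))
  · intro i hi j hj
    rw [hy'z, hz i j (by omega)]
    exact hb i hi j hj

open Cardinal in
lemma cell {o ν : K} (hν : ν ≠ o) {Y : Set (ℕ → S)} {h : (ℕ → S) → ℕ → ℕ → K}
    (hSK : (Infinite K ∧ Finite S) ∨ (ℵ₀ < #K ∧ #S ≤ #K))
    (hG : GoodBy o Y h) (P : Set (ℕ → S)) (hPc : IsClosed P) (hPi : interior P = ∅)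
    (b : (ℕ → S) → ℕ → ℕ → Bool) (hb : ∀ x x' i n, Agr n x x' → b x i n = b x' i n)
    (U V : Set (ℕ → S)) (hU : IsOpen U) (hV : IsOpen V) (hUne : U.Nonempty)
    (y : ℕ → S) (hyY : y ∈ Y) (hyV : y ∈ V) (n N0 : ℕ) :
    ∃ u' w : (ℕ → S) → Option (ℕ → S), IsLocallyConstant u' ∧ IsLocallyConstant w ∧
      (∀ o', (∃ x ∈ U, u' x = o') ↔ (∃ v ∈ V, w v = o')) ∧
      (∀ x ∈ P, x ∈ U → u' x ≠ none) ∧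
      (∀ x ∈ U, ∀ x' ∈ U, ∀ y', u' x = some y' → u' x' = some y' → Agr (n+1) x x') ∧
      (∀ x ∈ V, ∀ x' ∈ V, ∀ y', w x = some y' → w x' = some y' → Agr (n+1) x x') ∧
      (∀ x ∈ U, ∀ y', u' x = some y' → y' ∈ Y ∧ y' ∈ V ∧ w y' = some y' ∧
        Rel o h n N0 (fun i => b x i n) y y') := by
  classical
  obtain ⟨w0, hw0U, hw0P⟩ : ∃ w0 ∈ U, w0 ∉ P := by
    by_contra! hcon
    have : U ⊆ interior P := interior_maximal hcon hU
    rw [hPi] at this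
    exact absurd (this hUne.choose_spec) (Set.notMem_empty _)
  obtain ⟨N', hN'⟩ := mem_nhds_iff_agr.1 (hPc.isOpen_compl.mem_nhds hw0P)
  let N := max N' (n+1)
  have hNn : n + 1 ≤ N := le_max_right _ _
  let J := {t : List S // ∃ x ∈ P, x ∈ U ∧ pr N x = t}
  let D := {v | v ∈ V ∧ v ∈ Y ∧ (∀ i < n, h v i = h y i) ∧ Blk (n + N0) (h y) (h v)}
  have hD : Spread K D := good_spread hG y V hV n (n+N0)
  have hDne : D.Nonempty := ⟨y, hyV, hyY, fun _ _ => rfl, fun _ _ _ _ => rfl⟩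
  have hJ : (Infinite K ∧ Finite (Option J)) ∨ (ℵ₀ < #K ∧ #(Option J) ≤ #K) := by
    rcases hSK with ⟨h1, h2⟩ | ⟨h1, h2⟩
    · left
      refine ⟨h1, ?_⟩
      have : Finite J := by
        refine Set.Finite.subset (List.finite_length_eq S N) ?_
        rintro t ⟨x, _, _, rfl⟩
        simp [pr]
      infer_instance
    · right
      refine ⟨h1, ?_⟩
      have hJ1 : #J ≤ #K := (Cardinal.mk_subtype_le _).trans
        ((Cardinal.mk_list_le_max S).trans (max_le h1.le h2))
      rw [Cardinal.mk_option]
      exact Cardinal.add_le_of_le h1.le hJ1 (Cardinal.one_le_aleph0.trans h1.le)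
  obtain ⟨q, v, hq, hvD, hqv⟩ := comb hD hDne (Option J) hJ
  let Q : (ℕ → S) → (List S × List S) × List S := fun x => (q x, pr (n+1) x)
  have hQ : IsLocallyConstant Q := hq.prodMk (pr_loc (n+1))
  have hQv : ∀ a c, Q (v a) = Q (v c) → a = c := fun a c hac => hqv (Prod.mk.inj hac).1
  choose rep hrepP hrepU hrepN using fun t : J => t.2
  have hy' : ∀ t : J, ∃ y' ∈ Y, y' ∈ V ∩ {z | Q z = Q (v (some t))} ∧
      Rel o h n N0 (fun i => b (rep t) i n) y y' := by
    intro t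
    obtain ⟨h1, h2, h3, h4⟩ := hvD (some t)
    exact exists_rel hν hG y n N0 _ (v (some t)) h2 h3 h4 _
      (Filter.inter_mem (hV.mem_nhds h1) ((hQ.isOpen_fiber _).mem_nhds rfl))
  choose yy hyyY hyyV hyyR using hy'
  have hyinj : ∀ t t', yy t = yy t' → t = t' := by
    intro t t' htt
    have h1 := (hyyV t).2
    have h2 := (hyyV t').2
    rw [htt] at h1
    exact Option.some_injective _ (hQv _ _ (h1.symm.trans h2))
  let gu : List S → Option (ℕ → S) := fun l =>
    if H : ∃ x ∈ P, x ∈ U ∧ pr N x = l then some (yy ⟨l, H⟩) else none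
  let gw : (List S × List S) × List S → Option (ℕ → S) := fun c =>
    if H : ∃ t : J, c = Q (v (some t)) then some (yy H.choose) else none
  have hgu : ∀ x y', gu (pr N x) = some y' → ∃ t : J, t.1 = pr N x ∧ y' = yy t := by
    intro x y' hx
    by_cases H : ∃ x' ∈ P, x' ∈ U ∧ pr N x' = pr N x
    · simp only [gu, dif_pos H, Option.some.injEq] at hx
      exact ⟨⟨_, H⟩, rfl, hx.symm⟩
    · simp [gu, dif_neg H] at hx
  have hgw : ∀ t : J, ∀ x, Q x = Q (v (some t)) → gw (Q x) = some (yy t) := by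
    intro t x hx
    have H : ∃ t : J, Q x = Q (v (some t)) := ⟨t, hx⟩
    have : H.choose = t := Option.some_injective _ (hQv _ _ (H.choose_spec.symm.trans hx))
    simp only [gw, dif_pos H, this]
  have hgw' : ∀ x y', gw (Q x) = some y' → ∃ t : J, Q x = Q (v (some t)) ∧ y' = yy t := by
    intro x y' hx
    by_cases H : ∃ t : J, Q x = Q (v (some t))
    · simp only [gw, dif_pos H, Option.some.injEq] at hx
      exact ⟨_, H.choose_spec, hx.symm⟩
    · simp [gw, dif_neg H] at hx
  refine ⟨fun x => gu (pr N x), fun x => gw (Q x), (pr_loc N).comp gu, hQ.comp gw,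
    ?_, ?_, ?_, ?_, ?_⟩
  · rintro (_ | y')
    · refine iff_of_true ⟨w0, hw0U, ?_⟩ ⟨v none, (hvD none).1, ?_⟩
      · have : ¬ ∃ x' ∈ P, x' ∈ U ∧ pr N x' = pr N w0 := by
          rintro ⟨x', h1, _, h3⟩
          exact hN' x' ((pr_eq.1 h3.symm).mono (le_max_left _ _)) h1
        simp only [gu, dif_neg this]
      · have : ¬ ∃ t : J, Q (v none) = Q (v (some t)) := by
          rintro ⟨t, ht⟩
          exact absurd (hQv _ _ ht) (by simp)
        simp only [gw, dif_neg this]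
    · constructor
      · rintro ⟨x, hx, hx'⟩
        obtain ⟨t, -, rfl⟩ := hgu x y' hx'
        exact ⟨yy t, (hyyV t).1, hgw t _ (hyyV t).2⟩
      · rintro ⟨x, hx, hx'⟩
        obtain ⟨t, -, rfl⟩ := hgw' x y' hx'
        refine ⟨rep t, hrepU t, ?_⟩
        have H : ∃ x' ∈ P, x' ∈ U ∧ pr N x' = pr N (rep t) := ⟨rep t, hrepP t, hrepU t, rfl⟩
        simp only [gu, dif_pos H]
        congr 2
        exact Subtype.ext (hrepN t)
  · intro x hxP hxU
    have H : ∃ x' ∈ P, x' ∈ U ∧ pr N x' = pr N x := ⟨x, hxP, hxU, rfl⟩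
    simp [gu, dif_pos H]
  · intro x _ x' _ y' h1 h2
    obtain ⟨t, ht, e1⟩ := hgu x y' h1
    obtain ⟨t', ht', e2⟩ := hgu x' y' h2
    have : t = t' := hyinj _ _ (e1.symm.trans e2)
    subst this
    exact (pr_eq.1 (ht.symm.trans ht')).mono hNn
  · intro x _ x' _ y' h1 h2
    obtain ⟨t, ht, e1⟩ := hgw' x y' h1
    obtain ⟨t', ht', e2⟩ := hgw' x' y' h2
    have : t = t' := hyinj _ _ (e1.symm.trans e2)
    subst this
    exact pr_eq.1 (Prod.mk.inj (ht.trans ht'.symm)).2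
  · intro x _ y' h1
    obtain ⟨t, ht, rfl⟩ := hgu x y' h1
    refine ⟨hyyY t, (hyyV t).1, hgw t _ (hyyV t).2, ?_⟩
    have : (fun i => b x i n) = fun i => b (rep t) i n := by
      funext i
      apply hb
      have : Agr N x (rep t) := pr_eq.1 (by rw [hrepN t, ht])
      exact this.mono (by omega)
    rw [this]
    exact hyyR t

end good
end DH

namespace DH
section loc
variable {S : Type u} [TopologicalSpace S] [DiscreteTopology S] {K : Type u}

lemma clopen_homeo_iff (hS : Nonempty (S ≃ Bool) ∨ Infinite S) (A B : Set (ℕ → S))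
    (hA : IsClopen A) (hB : IsClopen B) (hAB : A.Nonempty ↔ B.Nonempty) :
    Nonempty (↥A ≃ₜ ↥B) := by
  by_cases h : A.Nonempty
  · obtain ⟨e⟩ := clopen_homeo hS A hA h
    obtain ⟨e'⟩ := clopen_homeo hS B hB (hAB.1 h)
    exact ⟨e.trans e'.symm⟩
  · have h1 := Set.not_nonempty_iff_eq_empty.1 h
    have h2 := Set.not_nonempty_iff_eq_empty.1 (fun h' => h (hAB.2 h'))
    rw [h1, h2]
    exact ⟨Homeomorph.refl _⟩

/-- States of the construction of the homeomorphism in the local lemma. -/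
structure St (Y P : Set (ℕ → S)) (n : ℕ) (f : (ℕ → S) ≃ₜ (ℕ → S))
    (u : (ℕ → S) → Option (ℕ → S)) : Prop where
  loc : IsLocallyConstant u
  base : ∀ x y, u x = some y → y ∈ Y ∧ u (f.symm y) = some y
  small : ∀ x x' y, u x = some y → u x' = some y → Agr n x x' ∧ Agr n (f x) (f x')
  live : ∀ x ∈ P, u x ≠ none

lemma combine_loc {A B : Type*} [TopologicalSpace A] (u : A → Option B) (hu : IsLocallyConstant u)
    (c : B → A → Option B) (hc : ∀ y, (∃ x, u x = some y) → IsLocallyConstant (c y)) :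
    IsLocallyConstant (fun x => (u x).bind (fun y => c y x)) := by
  rw [IsLocallyConstant.iff_eventually_eq] at hu ⊢
  intro x
  cases hx : u x with
  | none =>
    filter_upwards [hu x] with z hz
    rw [hz, hx]; rfl
  | some y =>
    have h1 := (IsLocallyConstant.iff_eventually_eq _).1 (hc y ⟨x, hx⟩) x
    filter_upwards [hu x, h1] with z hz hz'
    rw [hz, hx]
    exact hz'

open Cardinal in
lemma st_step (hS : Nonempty (S ≃ Bool) ∨ Infinite S)
    {o ν : K} (hν : ν ≠ o) {Y : Set (ℕ → S)} {h : (ℕ → S) → ℕ → ℕ → K}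
    (hSK : (Infinite K ∧ Finite S) ∨ (ℵ₀ < #K ∧ #S ≤ #K))
    (hG : GoodBy o Y h) (P : Set (ℕ → S)) (hPc : IsClosed P) (hPi : interior P = ∅)
    (b : (ℕ → S) → ℕ → ℕ → Bool) (hb : ∀ x x' i n, Agr n x x' → b x i n = b x' i n)
    (n N0 : ℕ) (f : (ℕ → S) ≃ₜ (ℕ → S)) (u : (ℕ → S) → Option (ℕ → S)) (hst : St Y P n f u) :
    ∃ (f' : (ℕ → S) ≃ₜ (ℕ → S)) (u' : (ℕ → S) → Option (ℕ → S)), St Y P (n+1) f' u' ∧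
      (∀ x, u x = none → u' x = none ∧ f' x = f x) ∧
      (∀ x y, u x = some y → u (f.symm (f' x)) = some y) ∧
      (∀ x y', u' x = some y' → ∃ y, u x = some y ∧ Rel o h n N0 (fun i => b x i n) y y') := by
  classical
  have hcell : ∀ y, ∃ u' w : (ℕ → S) → Option (ℕ → S), (∃ x, u x = some y) →
      IsLocallyConstant u' ∧ IsLocallyConstant w ∧
      (∀ o', (∃ x ∈ {x | u x = some y}, u' x = o') ↔
        (∃ v ∈ {v | u (f.symm v) = some y}, w v = o')) ∧
      (∀ x ∈ P, x ∈ {x | u x = some y} → u' x ≠ none) ∧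
      (∀ x ∈ {x | u x = some y}, ∀ x' ∈ {x | u x = some y}, ∀ y', u' x = some y' →
        u' x' = some y' → Agr (n+1) x x') ∧
      (∀ x ∈ {v | u (f.symm v) = some y}, ∀ x' ∈ {v | u (f.symm v) = some y}, ∀ y',
        w x = some y' → w x' = some y' → Agr (n+1) x x') ∧
      (∀ x ∈ {x | u x = some y}, ∀ y', u' x = some y' → y' ∈ Y ∧
        y' ∈ {v | u (f.symm v) = some y} ∧ w y' = some y' ∧
        Rel o h n N0 (fun i => b x i n) y y') := by
    intro y
    by_cases hy : ∃ x, u x = some y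
    · obtain ⟨x, hx⟩ := hy
      obtain ⟨h1, h2⟩ := hst.base x y hx
      obtain ⟨u', w, H⟩ := cell hν hSK hG P hPc hPi b hb {x | u x = some y}
        {v | u (f.symm v) = some y} (hst.loc.isOpen_fiber _)
        ((hst.loc.isOpen_fiber (some y)).preimage f.symm.continuous) ⟨x, hx⟩ y h1 h2 n N0
      exact ⟨u', w, fun _ => H⟩
    · exact ⟨fun _ => none, fun _ => none, fun h' => absurd h' hy⟩
  choose cu cw hc using hcell
  let u' : (ℕ → S) → Option (ℕ → S) := fun x => (u x).bind (fun y => cu y x)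
  let t : (ℕ → S) → Option (ℕ → S) := fun v => u (f.symm v)
  have ht : IsLocallyConstant t := hst.loc.comp_continuous f.symm.continuous
  let w : (ℕ → S) → Option (ℕ → S) := fun v => (t v).bind (fun y => cw y v)
  have hu' : IsLocallyConstant u' := combine_loc u hst.loc cu (fun y hy => (hc y hy).1)
  have hw : IsLocallyConstant w := combine_loc t ht cw (fun y hy => by
    obtain ⟨v, hv⟩ := hy
    exact (hc y ⟨_, hv⟩).2.1)
  have hu'n : ∀ x, u x = none → u' x = none := fun x hx => by simp [u', hx]
  have hu's : ∀ x y, u x = some y → u' x = cu y x := fun x y hx => by simp [u', hx]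
  have hwn : ∀ x, t x = none → w x = none := fun x hx => by simp [w, hx]
  have hws : ∀ x y, t x = some y → w x = cw y x := fun x y hx => by simp [w, hx]
  let c : (ℕ → S) → Option (ℕ → S) × Option (ℕ → S) := fun x => (u x, u' x)
  let d : (ℕ → S) → Option (ℕ → S) × Option (ℕ → S) := fun x => (t x, w x)
  have hcl : IsLocallyConstant c := hst.loc.prodMk hu'
  have hdl : IsLocallyConstant d := ht.prodMk hw
  have he : ∀ i, ∃ e : {x // c x = i} ≃ₜ {v // d v = i}, i.1 = none → ∀ a, (e a : ℕ → S) = f a := by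
    rintro ⟨i1, i2⟩
    cases i1 with
    | none =>
      refine ⟨f.subtype (fun x => ?_), fun _ a => rfl⟩
      have htf : t (f x) = u x := by simp [t]
      constructor
      · intro hx
        have h1 : u x = none := (Prod.mk.inj hx).1
        have h2 : u' x = i2 := (Prod.mk.inj hx).2
        have h3 : t (f x) = none := htf.trans h1
        simp only [d, h3, hwn _ h3, ← h2, hu'n _ h1]
      · intro hx
        have h1 : t (f x) = none := (Prod.mk.inj hx).1
        have h2 : w (f x) = i2 := (Prod.mk.inj hx).2
        have h3 : u x = none := htf.symm.trans h1
        simp only [c, h3, hwn _ h1, ← h2, hu'n _ h3]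
    | some y =>
      have : Nonempty ({x // c x = (some y, i2)} ≃ₜ {v // d v = (some y, i2)}) := by
        refine clopen_homeo_iff hS {x | c x = (some y, i2)} {v | d v = (some y, i2)}
          (hcl.isClopen_fiber _) (hdl.isClopen_fiber _) ?_
        constructor
        · rintro ⟨x, hx⟩
          have h1 : u x = some y := (Prod.mk.inj hx).1
          have h2 : u' x = i2 := (Prod.mk.inj hx).2
          rw [hu's x y h1] at h2
          obtain ⟨v, hv, hv'⟩ := ((hc y ⟨x, h1⟩).2.2.1 i2).1 ⟨x, h1, h2⟩
          exact ⟨v, Prod.ext hv ((hws v y hv).trans hv')⟩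
        · rintro ⟨v, hv⟩
          have h1 : t v = some y := (Prod.mk.inj hv).1
          have h2 : w v = i2 := (Prod.mk.inj hv).2
          rw [hws v y h1] at h2
          obtain ⟨x, hx, hx'⟩ := ((hc y ⟨_, h1⟩).2.2.1 i2).2 ⟨v, h1, h2⟩
          exact ⟨x, Prod.ext hx ((hu's x y hx).trans hx')⟩
      exact ⟨this.some, fun h => by simp at h⟩
  choose e he' using he
  obtain ⟨F, hF⟩ := glue c d hcl hdl e
  have hdF : ∀ a, d (F a) = c a := fun a => by rw [hF a]; exact (e (c a) ⟨a, rfl⟩).2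
  have htF : ∀ a, t (F a) = u a := fun a => (Prod.mk.inj (hdF a)).1
  have hwF : ∀ a, w (F a) = u' a := fun a => (Prod.mk.inj (hdF a)).2
  have hsome : ∀ x y', u' x = some y' → ∃ y, u x = some y ∧ cu y x = some y' := by
    intro x y' hx
    cases hux : u x with
    | none => rw [hu'n x hux] at hx; simp at hx
    | some y => exact ⟨y, rfl, (hu's x y hux).symm.trans hx⟩
  refine ⟨F, u', ⟨hu', ?_, ?_, ?_⟩, ?_, ?_, ?_⟩
  · intro x y' hx
    obtain ⟨y, h1, h2⟩ := hsome x y' hx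
    obtain ⟨h3, h4, h5, -⟩ := (hc y ⟨x, h1⟩).2.2.2.2.2.2 x h1 y' h2
    refine ⟨h3, ?_⟩
    have := hwF (F.symm y')
    rw [F.apply_symm_apply, hws y' y h4, h5] at this
    exact this.symm
  · intro x x' y' hx hx'
    obtain ⟨y, h1, h2⟩ := hsome x y' hx
    obtain ⟨z, h1', h2'⟩ := hsome x' y' hx'
    obtain ⟨-, h4, -, -⟩ := (hc y ⟨x, h1⟩).2.2.2.2.2.2 x h1 y' h2
    obtain ⟨-, h4', -, -⟩ := (hc z ⟨x', h1'⟩).2.2.2.2.2.2 x' h1' y' h2'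
    have h4a : u (f.symm y') = some y := h4
    have h4b : u (f.symm y') = some z := h4'
    have hyz : y = z := Option.some_injective _ (h4a.symm.trans h4b)
    subst hyz
    refine ⟨(hc y ⟨x, h1⟩).2.2.2.2.1 x h1 x' h1' y' h2 h2', ?_⟩
    have a1 : t (F x) = some y := (htF x).trans h1
    have a2 : t (F x') = some y := (htF x').trans h1'
    refine (hc y ⟨x, h1⟩).2.2.2.2.2.1 _ a1 _ a2 y' ?_ ?_
    · rw [← hws _ y a1, hwF, hx]
    · rw [← hws _ y a2, hwF, hx']
  · intro x hx hn
    cases hux : u x with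
    | none => exact hst.live x hx hux
    | some y =>
      rw [hu's x y hux] at hn
      exact (hc y ⟨x, hux⟩).2.2.2.1 x hx hux hn
  · intro x hx
    refine ⟨hu'n x hx, ?_⟩
    rw [hF x]
    exact he' (c x) hx ⟨x, rfl⟩
  · intro x y hx
    exact (htF x).trans hx
  · intro x y' hx
    obtain ⟨y, h1, h2⟩ := hsome x y' hx
    exact ⟨y, h1, ((hc y ⟨x, h1⟩).2.2.2.2.2.2 x h1 y' h2).2.2.2⟩

open Cardinal in
/-- The local lemma. -/
lemma local_lemma (hS : Nonempty (S ≃ Bool) ∨ Infinite S)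
    {o ν : K} (hν : ν ≠ o) {Y : Set (ℕ → S)} {h : (ℕ → S) → ℕ → ℕ → K}
    (hSK : (Infinite K ∧ Finite S) ∨ (ℵ₀ < #K ∧ #S ≤ #K))
    (hG : GoodBy o Y h) (P : Set (ℕ → S)) (hPc : IsClosed P) (hPi : interior P = ∅)
    (C : Set (ℕ → S)) (hC : FSD C) :
    ∃ f : (ℕ → S) ≃ₜ (ℕ → S), ∀ x ∈ P, (f x ∈ Y ↔ x ∈ C) := by
  classical
  obtain ⟨b, hb, hbC⟩ := hC.bits
  have hne : Nonempty (ℕ → S) := by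
    rcases hS with ⟨⟨e⟩⟩ | hS
    · exact ⟨fun _ => e.symm true⟩
    · exact ⟨fun _ => Classical.arbitrary S⟩
  obtain ⟨y0, hy0⟩ := hG.dense.nonempty
  obtain ⟨N0, hN0⟩ := hG.opn y0 hy0 Set.univ Filter.univ_mem
  let T : ℕ → Type u := fun n =>
    {p : ((ℕ → S) ≃ₜ (ℕ → S)) × ((ℕ → S) → Option (ℕ → S)) // St Y P n p.1 p.2}
  have hstep : ∀ n (p : T n), ∃ p' : T (n+1),
      (∀ x, p.1.2 x = none → p'.1.2 x = none ∧ p'.1.1 x = p.1.1 x) ∧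
      (∀ x y, p.1.2 x = some y → p.1.2 (p.1.1.symm (p'.1.1 x)) = some y) ∧
      (∀ x y', p'.1.2 x = some y' → ∃ y, p.1.2 x = some y ∧
        Rel o h n N0 (fun i => b x i n) y y') := by
    rintro n ⟨⟨f, u⟩, hp⟩
    obtain ⟨f', u', h1, h2⟩ := st_step hS hν hSK hG P hPc hPi b hb n N0 f u hp
    exact ⟨⟨(f', u'), h1⟩, h2⟩
  choose nxt hn1 hn2 hn3 using hstep
  let T0 : T 0 := ⟨(Homeomorph.refl _, fun _ => some y0), by
    refine ⟨IsLocallyConstant.const _, ?_, ?_, ?_⟩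
    · intro x y hxy
      obtain rfl := Option.some_injective _ hxy
      exact ⟨hy0, rfl⟩
    · intro x x' y _ _
      exact ⟨fun i hi => by omega, fun i hi => by omega⟩
    · intro x _
      simp⟩
  let s : ∀ n, T n := fun n => Nat.rec T0 nxt n
  have hs : ∀ n, s (n+1) = nxt n (s n) := fun n => rfl
  let f : ℕ → (ℕ → S) ≃ₜ (ℕ → S) := fun n => (s n).1.1
  let U : ℕ → (ℕ → S) → Option (ℕ → S) := fun n => (s n).1.2
  have hst : ∀ n, St Y P n (f n) (U n) := fun n => (s n).2
  have s1 : ∀ n x, U n x = none → f (n+1) x = f n x := fun n x hx => (hn1 n (s n) x hx).2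
  have s2 : ∀ n x y, U n x = some y → U n ((f n).symm (f (n+1) x)) = some y :=
    fun n x y hx => hn2 n (s n) x y hx
  have s3 : ∀ n x y', U (n+1) x = some y' → ∃ y, U n x = some y ∧
        Rel o h n N0 (fun i => b x i n) y y' := fun n x y' hx => hn3 n (s n) x y' hx
  obtain ⟨F, hF⟩ := limit_homeo f (by
    intro n x
    cases hx : U n x with
    | none => rw [s1 n x hx]; exact Agr.refl _ _
    | some y =>
      have := ((hst n).small _ _ y (s2 n x y hx) hx).2
      rwa [Homeomorph.apply_symm_apply] at this) (by
    intro n v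
    obtain ⟨x, rfl⟩ := (f (n+1)).surjective v
    rw [Homeomorph.symm_apply_apply]
    cases hx : U n x with
    | none => rw [s1 n x hx, Homeomorph.symm_apply_apply]; exact Agr.refl _ _
    | some y => exact ((hst n).small _ _ y hx (s2 n x y hx)).1)
  refine ⟨F, fun x hxP => ?_⟩
  have hy : ∀ n, ∃ y, U n x = some y := fun n =>
    Option.ne_none_iff_exists'.1 ((hst n).live x hxP)
  choose y hy using hy
  have hy00 : y 0 = y0 := (Option.some_injective _ (hy 0)).symm
  have hyY : ∀ n, y n ∈ Y := fun n => ((hst n).base x (y n) (hy n)).1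
  have hR : ∀ n, Rel o h n N0 (fun i => b x i n) (y n) (y (n+1)) := by
    intro n
    obtain ⟨z, hz, hz'⟩ := s3 n x _ (hy (n+1))
    rw [hy n] at hz
    obtain rfl := Option.some_injective _ hz
    exact hz'
  have hFy : ∀ n, Agr n (F x) (y n) := by
    intro n
    have h1 := ((hst n).small _ _ (y n) (hy n) ((hst n).base x (y n) (hy n)).2).2
    rw [Homeomorph.apply_symm_apply] at h1
    exact (hF n x).trans h1
  have hblk : ∀ i j n m, i < n + N0 → j < n + N0 → n ≤ m → h (y m) i j = h (y n) i j := by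
    intro i j n m hi hj hnm
    induction m, hnm using Nat.le_induction with
    | base => rfl
    | succ m hm ih => rw [← ih]; exact ((hR m).2.2.2 i (by omega) j (by omega)).symm
  rw [hbC]
  constructor
  · intro hFY i
    by_contra! hcon
    obtain ⟨L, hL⟩ := hG.fin _ hFY i
    obtain ⟨n, hn, hbn⟩ := hcon (max L (i+1))
    have hn1 := le_max_left L (i+1)
    have hn2 := le_max_right L (i+1)
    obtain ⟨M, hM, hMo⟩ := (hR n).2.1 i (by omega) (by simpa using hbn)
    have hpers : ∀ m, n + 1 ≤ m → h (y m) i M = h (y (n+1)) i M := by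
      intro m hm
      induction m, hm using Nat.le_induction with
      | base => rfl
      | succ m hm ih =>
        rw [← ih]
        exact (hR m).2.2.1 i (by omega) M (by rw [ih]; exact hMo)
    obtain ⟨m, hm⟩ := mem_nhds_iff_agr.1 (hG.cont _ hFY i M)
    have h3 := hm (y (max m (n+1))) ((hFy _).mono (le_max_left _ _)) (hyY _)
    rw [hpers _ (le_max_right _ _), hL M (by omega)] at h3
    exact hMo h3
  · intro hfin
    let z : ℕ → ℕ → K := fun i j => h (y (max i j + 1)) i j
    have hz : ∀ i j n, i < n → j < n → h (y n) i j = z i j := by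
      intro i j n hi hj
      have h1 := le_max_left i j
      have h2 := le_max_right i j
      exact hblk i j (max i j + 1) n (by omega) (by omega) (by omega)
    have hzf : Fin0 o z := by
      intro i
      obtain ⟨N, hN⟩ := hfin i
      have hrow : ∀ m, max N (i+1) ≤ m → h (y m) i = h (y (max N (i+1))) i := by
        intro m hm
        induction m, hm using Nat.le_induction with
        | base => rfl
        | succ m hm ih =>
          have h1 := le_max_left N (i+1)
          have h2 := le_max_right N (i+1)
          rw [← ih]
          exact (hR m).1 i (by omega) (hN m (by omega))
      obtain ⟨L, hL⟩ := hG.fin _ (hyY (max N (i+1))) i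
      refine ⟨L, fun j hj => ?_⟩
      rw [← hL j hj, ← hz i j (max N (i+1) + j + 1) (by
        have h2 := le_max_right N (i+1); omega) (by omega), hrow _ (by omega)]
    obtain ⟨y', hy', -, hy'z⟩ := hN0 z hzf (by
      intro i hi j hj
      rw [← hz i j (i + j + 1) (by omega) (by omega), ← hy00]
      exact (hblk i j 0 (i+j+1) (by omega) (by omega) (by omega)).symm)
    have : F x = y' := by
      funext i
      obtain ⟨N, hN⟩ := hG.opn y' hy' {v | Agr (i+1) y' v} (agr_mem_nhds _ _)
      obtain ⟨y'', h1, h2, h3⟩ := hN (h (y (N+i+1))) (hG.fin _ (hyY _)) (by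
        intro a ha c hc
        rw [hy'z]
        exact (hz a c _ (by omega) (by omega)).symm)
      have h4 := hG.inj _ h1 _ (hyY _) h3
      rw [h4] at h2
      rw [hFy (N+i+1) i (by omega)]
      exact (h2 i (by omega)).symm
    rw [this]
    exact hy'

end loc
end DH

namespace DH
section stage
variable {S : Type u} [TopologicalSpace S] [DiscreteTopology S] {K : Type u}

/-- Extending a self-homeomorphism of a clopen set by the identity. -/
lemma extend_id {X : Type*} [TopologicalSpace X] (W : Set X) (hW : IsClopen W) (e : ↥W ≃ₜ ↥W) :
    ∃ φ : X ≃ₜ X, ∀ x (hx : x ∈ W), φ x = (e ⟨x, hx⟩ : X) := by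
  classical
  have hcont : ∀ e : ↥W ≃ₜ ↥W, Continuous fun x => if hx : x ∈ W then (e ⟨x, hx⟩ : X) else x := by
    intro e
    rw [continuous_iff_continuousAt]
    intro x
    by_cases hx : x ∈ W
    · have h1 : ContinuousOn (fun x => if hx : x ∈ W then (e ⟨x, hx⟩ : X) else x) W := by
        rw [continuousOn_iff_continuous_domRestrict]
        have : W.domRestrict (fun x => if hx : x ∈ W then (e ⟨x, hx⟩ : X) else x)
            = fun w => (e w : X) := by
          funext w; simp [Set.domRestrict]
        rw [this]
        exact continuous_subtype_val.comp e.continuous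
      exact h1.continuousAt (hW.isOpen.mem_nhds hx)
    · have : (fun x => if hx : x ∈ W then (e ⟨x, hx⟩ : X) else x) =ᶠ[𝓝 x] id := by
        filter_upwards [hW.compl.isOpen.mem_nhds hx] with z hz
        exact dif_neg hz
      exact continuousAt_id.congr this.symm
  have hinv : ∀ e e' : ↥W ≃ₜ ↥W, (∀ w, e' (e w) = w) → Function.LeftInverse
      (fun x => if hx : x ∈ W then (e' ⟨x, hx⟩ : X) else x)
      (fun x => if hx : x ∈ W then (e ⟨x, hx⟩ : X) else x) := by
    intro e e' h x
    by_cases hx : x ∈ W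
    · simp [hx, h]
    · simp [hx]
  exact ⟨⟨⟨_, _, hinv e e.symm (by simp), hinv e.symm e (by simp)⟩, hcont e, hcont e.symm⟩,
    fun x hx => dif_pos hx⟩

lemma local_clopen (hS : Nonempty (S ≃ Bool) ∨ Infinite S) {o ν : K} (hν : ν ≠ o)
    (hSK : (Infinite K ∧ Finite S) ∨ (Cardinal.aleph0 < Cardinal.mk K ∧ Cardinal.mk S ≤ Cardinal.mk K))
    {Y : Set (ℕ → S)} {h : (ℕ → S) → ℕ → ℕ → K} (hG : GoodBy o Y h)
    (P : Set (ℕ → S)) (hPc : IsClosed P) (hPi : interior P = ∅)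
    (C : Set (ℕ → S)) (hC : FSD C) (W : Set (ℕ → S)) (hW : IsClopen W) :
    ∃ φ : (ℕ → S) ≃ₜ (ℕ → S), (∀ x ∈ W, φ x ∈ W) ∧ (∀ x ∈ W, φ.symm x ∈ W) ∧
      ∀ x ∈ P, x ∈ W → (φ x ∈ Y ↔ x ∈ C) := by
  by_cases hne : W.Nonempty
  · obtain ⟨ψ⟩ := clopen_homeo hS W hW hne
    have hj : IsOpenEmbedding (fun x => (ψ.symm x : ℕ → S)) :=
      hW.isOpen.isOpenEmbedding_subtypeVal.comp ψ.symm.isOpenEmbedding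
    obtain ⟨f, hf⟩ := local_lemma hS hν hSK (hG.comap _ hj) ((fun x => (ψ.symm x : ℕ → S)) ⁻¹' P)
      (hPc.preimage hj.continuous)
      (by rw [← hj.isOpenMap.preimage_interior_eq_interior_preimage hj.continuous, hPi]; rfl)
      _ (hC.comap _ hj.continuous)
    obtain ⟨φ, hφ⟩ := extend_id W hW ((ψ.trans f).trans ψ.symm)
    have h1 : ∀ x ∈ W, φ x ∈ W := fun x hx => by rw [hφ x hx]; exact Subtype.coe_prop _
    refine ⟨φ, h1, ?_, ?_⟩
    · intro x hx
      have h2 := hφ _ (((ψ.trans f).trans ψ.symm).symm ⟨x, hx⟩).2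
      have h3 : φ (((ψ.trans f).trans ψ.symm).symm ⟨x, hx⟩) = x := by
        rw [h2]; simp
      have : φ.symm x = (((ψ.trans f).trans ψ.symm).symm ⟨x, hx⟩ : ↥W) := by
        rw [Homeomorph.symm_apply_eq]; exact h3.symm
      rw [this]; exact Subtype.coe_prop _
    · intro x hx hxW
      have := hf (ψ ⟨x, hxW⟩) (by simpa using hx)
      rw [hφ x hxW]
      simpa using this
  · exact ⟨Homeomorph.refl _, fun x hx => hx, fun x hx => hx, fun x _ hx => (hne ⟨x, hx⟩).elim⟩

lemma stage_cont {I : Type*} (A : Set (ℕ → S)) (c : (ℕ → S) → I)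
    (hc : ∀ x ∉ A, ∀ᶠ x' in 𝓝 x, x' ∉ A ∧ c x' = c x) (Φ : I → (ℕ → S) → (ℕ → S))
    (hΦ : ∀ i, Continuous (Φ i)) (g : (ℕ → S) → (ℕ → S)) (hgA : ∀ x ∈ A, g x = x)
    (hg : ∀ x ∉ A, g x = Φ (c x) x) (hm : ∀ a ∈ A, ∀ m x, Agr m a x → Agr m x (g x)) :
    Continuous g := by
  rw [continuous_iff_continuousAt]
  intro x
  by_cases hx : x ∈ A
  · intro O hO
    rw [hgA x hx] at hO
    obtain ⟨m, hO⟩ := mem_nhds_iff_agr.1 hO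
    refine mem_map.2 (mem_of_superset (agr_mem_nhds m x) fun x' hx' => hO _ ?_)
    exact Agr.trans hx' (hm x hx m x' hx')
  · have : Φ (c x) =ᶠ[𝓝 x] g := by
      filter_upwards [hc x hx] with z hz
      rw [hg z hz.1, hz.2]
    exact (hΦ _).continuousAt.congr this

lemma stage (hS : Nonempty (S ≃ Bool) ∨ Infinite S) {o ν : K} (hν : ν ≠ o)
    (hSK : (Infinite K ∧ Finite S) ∨ (Cardinal.aleph0 < Cardinal.mk K ∧ Cardinal.mk S ≤ Cardinal.mk K))
    {Y : Set (ℕ → S)} {h : (ℕ → S) → ℕ → ℕ → K} (hG : GoodBy o Y h)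
    (A : Set (ℕ → S)) (hA : IsClosed A)
    (P : Set (ℕ → S)) (hPc : IsClosed P) (hPi : interior P = ∅)
    (C : Set (ℕ → S)) (hC : FSD C) (hAC : ∀ a ∈ A, (a ∈ Y ↔ a ∈ C))
    {T : Type*} (p : (ℕ → S) → T) (hp : IsLocallyConstant p) :
    ∃ φ : (ℕ → S) ≃ₜ (ℕ → S), (∀ a ∈ A, φ a = a) ∧ (∀ x, p (φ x) = p x) ∧
      ∀ x ∈ A ∪ P, (φ x ∈ Y ↔ x ∈ C) := by
  classical
  have hex : ∀ x ∉ A, ∃ n, ∀ a ∈ A, ¬ Agr n x a := by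
    intro x hx
    obtain ⟨n, hn⟩ := mem_nhds_iff_agr.1 (hA.isOpen_compl.mem_nhds hx)
    exact ⟨n, fun a ha h => hn a h ha⟩
  let n : (ℕ → S) → ℕ := fun x => sInf {n | ∀ a ∈ A, ¬ Agr n x a}
  have hn : ∀ x ∉ A, ∀ a ∈ A, ¬ Agr (n x) x a := fun x hx => Nat.sInf_mem (hex x hx)
  have hn' : ∀ x m, (∀ a ∈ A, ¬ Agr m x a) → n x ≤ m := fun x m hm => Nat.sInf_le hm
  have hfar : ∀ a ∈ A, ∀ m x, x ∉ A → Agr m a x → m < n x := by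
    intro a ha m x hx hm
    by_contra hlt
    exact hn x hx a ha (hm.symm.mono (not_lt.1 hlt))
  let c : (ℕ → S) → List S × T := fun x => (pr (n x) x, p x)
  have hcn : ∀ x x', c x = c x' → n x = n x' ∧ Agr (n x) x x' ∧ p x = p x' := by
    intro x x' hh
    have h1 : pr (n x) x = pr (n x') x' := congrArg Prod.fst hh
    have h2 : n x = n x' := by
      have := congrArg List.length h1
      simpa [pr] using this
    rw [← h2] at h1
    exact ⟨h2, pr_eq.1 h1, congrArg Prod.snd hh⟩
  have hc : ∀ x ∉ A, ∀ᶠ x' in 𝓝 x, x' ∉ A ∧ c x' = c x := by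
    intro x hx
    filter_upwards [agr_mem_nhds (n x) x, hp.eventually_eq x] with x' hx' hpx
    have hx' : Agr (n x) x x' := hx'
    have h1 : x' ∉ A := fun h => hn x hx x' h hx'
    have h2 : n x' ≤ n x := hn' _ _ fun a ha hh => hn x hx a ha (hx'.trans hh)
    have h3 : n x ≤ n x' := hn' _ _ fun a ha hh => hn x' h1 a ha ((hx'.mono h2).symm.trans hh)
    have h4 : n x' = n x := le_antisymm h2 h3
    refine ⟨h1, Prod.ext ?_ hpx⟩
    show pr (n x') x' = pr (n x) x
    rw [h4]; exact pr_eq.2 hx'.symm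
  have hW : ∀ i, IsClopen {x | x ∉ A ∧ c x = i} := by
    intro i
    constructor
    · rw [← isOpen_compl_iff, isOpen_iff_mem_nhds]
      intro x hx
      by_cases hxA : x ∈ A
      · filter_upwards [agr_mem_nhds i.1.length x] with x' hx'
        rintro ⟨h1, h2⟩
        have h3 := hfar x hxA _ x' h1 hx'
        rw [← h2] at h3
        simp [c, pr] at h3
      · filter_upwards [hc x hxA] with x' hx'
        rintro ⟨h1, h2⟩
        exact hx ⟨hxA, hx'.2.symm.trans h2⟩
    · rw [isOpen_iff_mem_nhds]
      rintro x ⟨h1, h2⟩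
      filter_upwards [hc x h1] with x' hx'
      exact ⟨hx'.1, hx'.2.trans h2⟩
  choose Φ hΦ1 hΦ2 hΦ3 using fun i => local_clopen hS hν hSK hG P hPc hPi C hC _ (hW i)
  let g : (ℕ → S) → (ℕ → S) := fun x => if x ∈ A then x else Φ (c x) x
  let g' : (ℕ → S) → (ℕ → S) := fun x => if x ∈ A then x else (Φ (c x)).symm x
  have hgA : ∀ x ∈ A, g x = x := fun x hx => if_pos hx
  have hgA' : ∀ x ∈ A, g' x = x := fun x hx => if_pos hx
  have hg : ∀ x ∉ A, g x = Φ (c x) x := fun x hx => if_neg hx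
  have hg' : ∀ x ∉ A, g' x = (Φ (c x)).symm x := fun x hx => if_neg hx
  have hgc : ∀ x ∉ A, g x ∉ A ∧ c (g x) = c x := fun x hx => by
    rw [hg x hx]; exact hΦ1 (c x) x ⟨hx, rfl⟩
  have hgc' : ∀ x ∉ A, g' x ∉ A ∧ c (g' x) = c x := fun x hx => by
    rw [hg' x hx]; exact hΦ2 (c x) x ⟨hx, rfl⟩
  have cont1 : Continuous g := by
    refine stage_cont A c hc (fun i => Φ i) (fun i => (Φ i).continuous) g hgA hg ?_
    intro a ha m x hax
    by_cases hx : x ∈ A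
    · rw [hgA x hx]; exact Agr.refl _ _
    · exact ((hcn _ _ (hgc x hx).2.symm).2.1).mono (hfar a ha m x hx hax).le
  have cont2 : Continuous g' := by
    refine stage_cont A c hc (fun i => (Φ i).symm) (fun i => (Φ i).symm.continuous) g' hgA' hg' ?_
    intro a ha m x hax
    by_cases hx : x ∈ A
    · rw [hgA' x hx]; exact Agr.refl _ _
    · exact ((hcn _ _ (hgc' x hx).2.symm).2.1).mono (hfar a ha m x hx hax).le
  refine ⟨⟨⟨g, g', ?_, ?_⟩, cont1, cont2⟩, hgA, ?_, ?_⟩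
  · intro x
    by_cases hx : x ∈ A
    · rw [hgA x hx, hgA' x hx]
    · rw [hg' _ (hgc x hx).1, (hgc x hx).2, hg x hx]; simp
  · intro x
    by_cases hx : x ∈ A
    · rw [hgA' x hx, hgA x hx]
    · rw [hg _ (hgc' x hx).1, (hgc' x hx).2, hg' x hx]; simp
  · intro x
    show p (g x) = p x
    by_cases hx : x ∈ A
    · rw [hgA x hx]
    · exact ((hcn _ _ (hgc x hx).2).2.2)
  · intro x hx
    show g x ∈ Y ↔ x ∈ C
    by_cases hxA : x ∈ A
    · rw [hgA x hxA]; exact hAC x hxA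
    · rw [hg x hxA]
      exact hΦ3 _ x (hx.resolve_left hxA) ⟨hxA, rfl⟩

/-- One forward step of the back-and-forth construction. -/
lemma fwd (hS : Nonempty (S ≃ Bool) ∨ Infinite S) {o ν : K} (hν : ν ≠ o)
    (hSK : (Infinite K ∧ Finite S) ∨ (Cardinal.aleph0 < Cardinal.mk K ∧ Cardinal.mk S ≤ Cardinal.mk K))
    {Y : Set (ℕ → S)} {h : (ℕ → S) → ℕ → ℕ → K} (hG : GoodBy o Y h)
    {C : Set (ℕ → S)} (hC : FSD C) (f : (ℕ → S) ≃ₜ (ℕ → S))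
    (A : Set (ℕ → S)) (hA : IsClosed A) (hf : ∀ a ∈ A, (f a ∈ Y ↔ a ∈ C))
    (P : Set (ℕ → S)) (hPc : IsClosed P) (hPi : interior P = ∅) (n : ℕ) :
    ∃ f' : (ℕ → S) ≃ₜ (ℕ → S), (∀ a ∈ A, f' a = f a) ∧ (∀ x, Agr n (f' x) (f x)) ∧
      (∀ x, Agr n (f'.symm x) (f.symm x)) ∧ ∀ a ∈ A ∪ P, (f' a ∈ Y ↔ a ∈ C) := by
  obtain ⟨φ, h1, h2, h3⟩ := stage hS hν hSK hG (f '' A) (f.isClosedMap _ hA) (f '' P)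
    (f.isClosedMap _ hPc) (by rw [← f.image_interior, hPi, image_empty]) (f.symm ⁻¹' C)
    (hC.comap _ f.symm.continuous)
    (by rintro _ ⟨a, ha, rfl⟩; simpa using hf a ha)
    (fun x => (pr n x, pr n (f.symm x)))
    ((pr_loc n).prodMk ((pr_loc n).comp_continuous f.symm.continuous))
  have h4 : ∀ x, Agr n (φ x) x := fun x => pr_eq.1 (congrArg Prod.fst (h2 x))
  have h5 : ∀ x, Agr n (f.symm (φ x)) (f.symm x) := fun x => pr_eq.1 (congrArg Prod.snd (h2 x))
  refine ⟨f.trans φ, fun a ha => h1 _ ⟨a, ha, rfl⟩, fun x => h4 _, ?_, ?_⟩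
  · intro x
    have := h5 (φ.symm x)
    rw [φ.apply_symm_apply] at this
    exact this.symm
  · intro a ha
    have := h3 (f a) (ha.imp (fun h => ⟨a, h, rfl⟩) (fun h => ⟨a, h, rfl⟩))
    simpa using this

lemma main_lemma (hS : Nonempty (S ≃ Bool) ∨ Infinite S) {o ν : K} (hν : ν ≠ o)
    (hSK : (Infinite K ∧ Finite S) ∨ (Cardinal.aleph0 < Cardinal.mk K ∧ Cardinal.mk S ≤ Cardinal.mk K))
    {Y₁ Y₂ : Set (ℕ → S)} {h₁ h₂ : (ℕ → S) → ℕ → ℕ → K} (hG₁ : GoodBy o Y₁ h₁)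
    (hG₂ : GoodBy o Y₂ h₂) (hF₁ : FSD Y₁) (hF₂ : FSD Y₂)
    (P₁ P₂ : ℕ → Set (ℕ → S)) (hc₁ : ∀ m, IsClosed (P₁ m)) (hc₂ : ∀ m, IsClosed (P₂ m))
    (hi₁ : ∀ m, interior (P₁ m) = ∅) (hi₂ : ∀ m, interior (P₂ m) = ∅)
    (hY₁ : ∀ y ∈ Y₁, ∃ m, y ∈ P₁ m) (hY₂ : ∀ y ∈ Y₂, ∃ m, y ∈ P₂ m) :
    ∃ f : (ℕ → S) ≃ₜ (ℕ → S), f '' Y₁ = Y₂ := by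
  let St := {q : ((ℕ → S) ≃ₜ (ℕ → S)) × Set (ℕ → S) //
    IsClosed q.2 ∧ ∀ a ∈ q.2, (q.1 a ∈ Y₂ ↔ a ∈ Y₁)}
  have step : ∀ (n : ℕ) (s : St), ∃ s' : St, (∀ a ∈ s.1.2, s'.1.1 a = s.1.1 a) ∧
      (∀ x, Agr n (s'.1.1 x) (s.1.1 x)) ∧ (∀ x, Agr n (s'.1.1.symm x) (s.1.1.symm x)) ∧
      s.1.2 ⊆ s'.1.2 ∧ P₁ n ⊆ s'.1.2 ∧ s'.1.1.symm '' P₂ n ⊆ s'.1.2 := by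
    rintro n ⟨⟨f, A⟩, hA, hf⟩
    obtain ⟨f1, a1, a2, a3, a4⟩ := fwd hS hν hSK hG₂ hF₁ f A hA hf (P₁ n) (hc₁ n) (hi₁ n) n
    obtain ⟨f2, b1, b2, b3, b4⟩ := fwd hS hν hSK hG₁ hF₂ f1.symm (f1 '' (A ∪ P₁ n))
      (f1.isClosedMap _ (hA.union (hc₁ n)))
      (by rintro _ ⟨a, ha, rfl⟩; simpa using (a4 a ha).symm) (P₂ n) (hc₂ n) (hi₂ n) n
    have e : ∀ a ∈ A ∪ P₁ n, f2.symm a = f1 a := by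
      intro a ha
      have := b1 _ ⟨a, ha, rfl⟩
      rw [f1.symm_apply_apply] at this
      rw [Homeomorph.symm_apply_eq]; exact this.symm
    refine ⟨⟨⟨f2.symm, (A ∪ P₁ n) ∪ f2 '' P₂ n⟩, ((hA.union (hc₁ n)).union
      (f2.isClosedMap _ (hc₂ n))), ?_⟩, ?_, ?_, ?_, ?_, ?_, ?_⟩
    · rintro a (ha | ⟨b, hb, rfl⟩)
      · show f2.symm a ∈ Y₂ ↔ a ∈ Y₁
        rw [e a ha]; exact a4 a ha
      · show f2.symm (f2 b) ∈ Y₂ ↔ f2 b ∈ Y₁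
        rw [f2.symm_apply_apply]; exact (b4 b (Or.inr hb)).symm
    · intro a ha
      exact (e a (Or.inl ha)).trans (a1 a ha)
    · intro x
      exact Agr.trans (b3 x) (a2 x)
    · intro x
      exact Agr.trans (b2 x) (a3 x)
    · exact fun a ha => Or.inl (Or.inl ha)
    · exact fun a ha => Or.inl (Or.inr ha)
    · exact fun a ha => Or.inr ha
  choose nxt n1 n2 n3 n4 n5 n6 using step
  let s0 : St := ⟨⟨Homeomorph.refl _, ∅⟩, isClosed_empty, by simp⟩
  let s : ℕ → St := fun n => Nat.rec s0 (fun n s => nxt n s) n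
  have hs : ∀ n, s (n+1) = nxt n (s n) := fun n => rfl
  obtain ⟨F, hF⟩ := limit_homeo (fun n => (s n).1.1) (fun n x => by simpa [hs] using n2 n (s n) x)
    (fun n x => by simpa [hs] using n3 n (s n) x)
  have hst : ∀ n m, n ≤ m → (s n).1.2 ⊆ (s m).1.2 ∧ ∀ a ∈ (s n).1.2, (s m).1.1 a = (s n).1.1 a := by
    intro n m hnm
    induction m, hnm using Nat.le_induction with
    | base => exact ⟨Subset.rfl, fun _ _ => rfl⟩
    | succ m hm ih =>
      rw [hs]
      exact ⟨ih.1.trans (n4 m (s m)), fun a ha => (n1 m (s m) a (ih.1 ha)).trans (ih.2 a ha)⟩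
  have hFn : ∀ n, ∀ a ∈ (s n).1.2, F a = (s n).1.1 a := by
    intro n a ha
    funext i
    have h1 := hF (max n (i+1)) a i (by omega)
    have h2 := (hst n (max n (i+1)) (le_max_left _ _)).2 a ha
    rw [← h2]; exact h1
  refine ⟨F, Subset.antisymm ?_ ?_⟩
  · rintro _ ⟨y, hy, rfl⟩
    obtain ⟨m, hm⟩ := hY₁ y hy
    have h1 : y ∈ (s (m+1)).1.2 := n5 m (s m) hm
    rw [hFn (m+1) y h1]
    exact ((s (m+1)).2.2 y h1).2 hy
  · intro y hy
    obtain ⟨m, hm⟩ := hY₂ y hy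
    have h1 : (s (m+1)).1.1.symm y ∈ (s (m+1)).1.2 := n6 m (s m) ⟨y, hm, rfl⟩
    refine ⟨(s (m+1)).1.1.symm y, ?_, ?_⟩
    · rw [← (s (m+1)).2.2 _ h1]; simpa using hy
    · rw [hFn (m+1) _ h1]; simp
end stage
end DH

namespace DH
section good
variable {S : Type u} [TopologicalSpace S] [DiscreteTopology S] {K : Type u}

lemma dense_agr {Y : Set (ℕ → S)} (hY : Dense Y) (m : ℕ) (x : ℕ → S) : ∃ y ∈ Y, Agr m x y := by
  obtain ⟨y, h1, h2⟩ := hY.inter_open_nonempty _ (isOpen_agr m x) ⟨x, Agr.refl _ _⟩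
  exact ⟨y, h2, h1⟩

/-- The pieces witnessing that `Y` is of first category. -/
def Pc (o : K) (Y : Set (ℕ → S)) (h : (ℕ → S) → ℕ → ℕ → K) (m : ℕ) : Set (ℕ → S) :=
  closure {y | y ∈ Y ∧ ∀ j ≥ m, h y 0 j = o}

lemma Pc_cover {o : K} {Y : Set (ℕ → S)} {h : (ℕ → S) → ℕ → ℕ → K} (hG : GoodBy o Y h) :
    ∀ y ∈ Y, ∃ m, y ∈ Pc o Y h m := by
  intro y hy
  obtain ⟨m, hm⟩ := hG.fin y hy 0
  exact ⟨m, subset_closure ⟨hy, hm⟩⟩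

lemma Pc_interior {o ν : K} (hν : ν ≠ o) {Y : Set (ℕ → S)} {h : (ℕ → S) → ℕ → ℕ → K}
    (hG : GoodBy o Y h) (m : ℕ) : interior (Pc o Y h m) = ∅ := by
  classical
  by_contra hne
  obtain ⟨y, hyU, hy⟩ := hG.dense.inter_open_nonempty _ isOpen_interior
    (Set.nonempty_iff_ne_empty.2 hne)
  obtain ⟨N, hN⟩ := hG.opn y hy _ (isOpen_interior.mem_nhds hyU)
  obtain ⟨y', hy', hyU', hz⟩ := hN
    (fun i j => if i = 0 ∧ j = max N m then ν else h y i j) (by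
      intro i
      obtain ⟨M, hM⟩ := hG.fin y hy i
      refine ⟨max M (max N m + 1), fun j hj => ?_⟩
      have : ¬ (i = 0 ∧ j = max N m) := by omega
      simp only [this, if_false]
      exact hM j (by omega)) (by
      intro i hi j hj
      have : ¬ (i = 0 ∧ j = max N m) := by omega
      simp only [this, if_false])
  have h1 : h y' 0 (max N m) = ν := by rw [hz]; simp
  have h2 := hG.cont y' hy' 0 (max N m)
  have h3 : y' ∈ closure {y | y ∈ Y ∧ ∀ j ≥ m, h y 0 j = o} := interior_subset hyU'
  obtain ⟨w, hw1, hw2, hw3⟩ := mem_closure_iff_nhds.1 h3 _ h2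
  have h4 := hw1 hw2
  rw [hw3 _ (le_max_right _ _), h1] at h4
  exact hν h4.symm

lemma good_FSD {o : K} {Y : Set (ℕ → S)} {h : (ℕ → S) → ℕ → ℕ → K} (hG : GoodBy o Y h)
    (hsurj : ∀ z, Fin0 o z → ∃ y ∈ Y, h y = z) : FSD Y := by
  refine ⟨fun i m => {x | ∀ y ∈ Y, ∀ y' ∈ Y, Agr m x y → Agr m x y' → Blk i (h y) (h y')} ∩
    closure {y | y ∈ Y ∧ ∀ j ≥ m, h y i j = o}, fun i m => ?_, fun x => ⟨?_, ?_⟩⟩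
  · refine IsClosed.inter ?_ isClosed_closure
    rw [← isOpen_compl_iff, isOpen_iff_mem_nhds]
    intro x hx
    refine mem_of_superset (agr_mem_nhds m x) fun x' hx' hc => hx ?_
    intro y hy y' hy' h1 h2
    have hx' : Agr m x x' := hx'
    exact hc y hy y' hy' (hx'.symm.trans h1) (hx'.symm.trans h2)
  · intro hx i
    have h1 : ∀ᶠ y in 𝓝 x, ∀ a ∈ Finset.range i, ∀ b ∈ Finset.range i,
        (y ∈ Y → h y a b = h x a b) := by
      rw [Filter.eventually_all_finset]
      intro a _
      rw [Filter.eventually_all_finset]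
      intro b _
      exact hG.cont x hx a b
    obtain ⟨m1, hm1⟩ := mem_nhds_iff_agr.1 h1
    obtain ⟨m2, hm2⟩ := hG.fin x hx i
    refine ⟨max m1 m2, ?_, subset_closure ⟨hx, fun j hj => hm2 j (le_trans (le_max_right _ _) hj)⟩⟩
    intro y hy y' hy' a1 a2 a ha b hb
    have e1 := hm1 y (a1.mono (le_max_left _ _)) a (by simpa using ha) b (by simpa using hb) hy
    have e2 := hm1 y' (a2.mono (le_max_left _ _)) a (by simpa using ha) b (by simpa using hb) hy'
    exact e1.trans e2.symm
  · intro hx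
    choose m hm1 hm2 using hx
    choose d hd1 hd2 using fun i => dense_agr hG.dense (m i) x
    let z : ℕ → ℕ → K := fun i j => h (d (max i j + 1)) i j
    have hz : ∀ N, ∀ y ∈ Y, Agr (m N) x y → Blk N (h y) z := by
      intro N y hy hxy a ha b hb
      obtain ⟨w, hw, hxw⟩ := dense_agr hG.dense (max (m N) (m (max a b + 1))) x
      have e1 := hm1 N y hy w hw hxy (hxw.mono (le_max_left _ _)) a ha b hb
      have e2 := hm1 (max a b + 1) w hw _ (hd1 _) (hxw.mono (le_max_right _ _)) (hd2 _) a
        (by omega) b (by omega)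
      exact e1.trans e2
    have hz0 : Fin0 o z := by
      intro i
      refine ⟨m i, fun j hj => ?_⟩
      obtain ⟨w, hw1, hw2, hw3⟩ := mem_closure_iff_nhds.1 (hm2 i) _
        (agr_mem_nhds (m (max i j + 1)) x)
      rw [← hz (max i j + 1) w hw2 hw1 i (by omega) j (by omega)]
      exact hw3 j hj
    obtain ⟨y, hy, hyz⟩ := hsurj z hz0
    have : x = y := by
      funext n
      obtain ⟨N, hN⟩ := hG.opn y hy _ (agr_mem_nhds (n+1) y)
      obtain ⟨w, hw, hxw⟩ := dense_agr hG.dense (max (m N) (n+1)) x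
      obtain ⟨y', hy', h1, h2⟩ := hN (h w) (hG.fin w hw) (by
        intro a ha b hb
        rw [hyz]
        exact (hz N w hw (hxw.mono (le_max_left _ _)) a ha b hb).symm)
      have h3 := hG.inj _ hy' _ hw h2
      subst h3
      have h1 : Agr (n+1) y y' := h1
      exact ((hxw.mono (le_max_right _ _)).trans h1.symm) n (by omega)
    rw [this]; exact hy

lemma good_of_homeo [TopologicalSpace K] [DiscreteTopology K] {o : K} {Y : Set (ℕ → S)}
    (hd : Dense Y) (e : ↥Y ≃ₜ (ℕ → {x : ℕ → K // ∀ᶠ n in atTop, x n = o})) :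
    ∃ h : (ℕ → S) → ℕ → ℕ → K, GoodBy o Y h ∧ ∀ z, Fin0 o z → ∃ y ∈ Y, h y = z := by
  classical
  let h : (ℕ → S) → ℕ → ℕ → K := fun y i j => if hy : y ∈ Y then (e ⟨y, hy⟩ i).1 j else o
  have hh : ∀ y (hy : y ∈ Y), h y = fun i j => (e ⟨y, hy⟩ i).1 j := by
    intro y hy
    funext i j
    exact dif_pos hy
  have hext : ∀ w w' : ℕ → {x : ℕ → K // ∀ᶠ n in atTop, x n = o},
      (∀ i j, (w i).1 j = (w' i).1 j) → w = w' := by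
    intro w w' hw
    funext i
    exact Subtype.ext (funext fun j => hw i j)
  have hmk : ∀ z : ℕ → ℕ → K, Fin0 o z → ∃ w : ℕ → {x : ℕ → K // ∀ᶠ n in atTop, x n = o},
      ∀ i, (w i).1 = z i := by
    intro z hz
    exact ⟨fun i => ⟨z i, eventually_atTop.2 (hz i)⟩, fun i => rfl⟩
  refine ⟨h, ⟨hd, ?_, ?_, ?_, ?_⟩, ?_⟩
  · intro y hy i
    rw [hh y hy]
    exact eventually_atTop.1 (e ⟨y, hy⟩ i).2
  · intro y hy i j
    have hc : Continuous fun w : ↥Y => (e w i).1 j :=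
      (continuous_apply j).comp (continuous_subtype_val.comp ((continuous_apply i).comp e.continuous))
    have h1 : {w : ↥Y | (e w i).1 j = (e ⟨y, hy⟩ i).1 j} ∈ 𝓝 (⟨y, hy⟩ : ↥Y) :=
      ((isOpen_discrete {v : K | v = (e ⟨y, hy⟩ i).1 j}).preimage hc).mem_nhds rfl
    rw [mem_nhds_subtype] at h1
    obtain ⟨U, hU, hUs⟩ := h1
    filter_upwards [hU] with y' hy'U hy'
    have := @hUs ⟨y', hy'⟩ hy'U
    rw [hh y hy, hh y' hy']
    exact this
  · intro y hy O hO
    by_contra hcon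
    push Not at hcon
    choose z hz1 hz2 hz3 using hcon
    choose w hw using fun N => hmk (z N) (hz1 N)
    have hlim : Tendsto w atTop (𝓝 (e ⟨y, hy⟩)) := by
      rw [tendsto_pi_nhds]
      intro i
      rw [tendsto_subtype_rng, tendsto_pi_nhds]
      intro j
      refine tendsto_const_nhds.congr' ?_
      filter_upwards [eventually_ge_atTop (max i j + 1)] with N hN
      rw [hw]
      have := hz2 N i (by omega) j (by omega)
      rw [hh y hy] at this
      exact this
    have hlim2 : Tendsto (fun N => (e.symm (w N) : ℕ → S)) atTop (𝓝 y) := by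
      have := (continuous_subtype_val.comp e.symm.continuous).continuousAt.tendsto.comp hlim
      simpa [Function.comp_def] using this
    obtain ⟨N, hN⟩ := (hlim2.eventually hO).exists
    refine hz3 N _ (e.symm (w N)).2 hN ?_
    rw [hh _ (e.symm (w N)).2]
    funext i j
    simp [hw]
  · intro y hy y' hy' heq
    rw [hh y hy, hh y' hy'] at heq
    have := e.injective (hext _ _ fun i j => congrFun (congrFun heq i) j)
    exact congrArg Subtype.val this
  · intro z hz
    obtain ⟨w, hw⟩ := hmk z hz
    refine ⟨_, (e.symm w).2, ?_⟩
    rw [hh _ (e.symm w).2]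
    funext i j
    simp [hw]

lemma final [TopologicalSpace K] [DiscreteTopology K]
    (hS : Nonempty (S ≃ Bool) ∨ Infinite S) {o ν : K} (hν : ν ≠ o)
    (hSK : (Infinite K ∧ Finite S) ∨ (Cardinal.aleph0 < Cardinal.mk K ∧ Cardinal.mk S ≤ Cardinal.mk K))
    {Y₁ Y₂ : Set (ℕ → S)} (hd₁ : Dense Y₁) (hd₂ : Dense Y₂)
    (e₁ : ↥Y₁ ≃ₜ (ℕ → {x : ℕ → K // ∀ᶠ n in atTop, x n = o}))
    (e₂ : ↥Y₂ ≃ₜ (ℕ → {x : ℕ → K // ∀ᶠ n in atTop, x n = o})) :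
    ∃ f : (ℕ → S) ≃ₜ (ℕ → S), f '' Y₁ = Y₂ := by
  obtain ⟨h₁, g₁, s₁⟩ := good_of_homeo hd₁ e₁
  obtain ⟨h₂, g₂, s₂⟩ := good_of_homeo hd₂ e₂
  exact main_lemma hS hν hSK g₁ g₂ (good_FSD g₁ s₁) (good_FSD g₂ s₂) (Pc o Y₁ h₁) (Pc o Y₂ h₂)
    (fun _ => isClosed_closure) (fun _ => isClosed_closure) (Pc_interior hν g₁) (Pc_interior hν g₂)
    (Pc_cover g₁) (Pc_cover g₂)
end good
end DH

/-- `B*(k)` is densely homogeneous with respect to `Q(k)^ω`. -/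
theorem stmt_9 (k : Cardinal.{u}) (hk : Cardinal.aleph0 ≤ k)
    (Y₁ Y₂ : Set (BaireStar k)) (hd₁ : Dense Y₁) (hd₂ : Dense Y₂)
    (he₁ : IsQkOmega k ↥Y₁) (he₂ : IsQkOmega k ↥Y₂) :
    ∃ f : BaireStar k ≃ₜ BaireStar k, f '' Y₁ = Y₂ := by
  obtain ⟨e₁⟩ := he₁
  obtain ⟨e₂⟩ := he₂
  have hD : Cardinal.mk (DiscT k) = k := Cardinal.mk_out k
  have hDi : Infinite (DiscT k) := Cardinal.infinite_iff.2 (by rw [hD]; exact hk)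
  obtain ⟨d⟩ : Nonempty (DiscT k) := inferInstance
  have hle : k ≤ Cardinal.mk (QBase k) := by
    have := Cardinal.mk_le_of_injective
      (Sum.inl_injective : Function.Injective (Sum.inl : DiscT k → DiscT k ⊕ PUnit.{u + 1}))
    rw [hD] at this
    exact this
  have hν : (Sum.inl d : QBase k) ≠ Sum.inr PUnit.unit := by
    intro h
    exact Sum.inl_ne_inr h
  have hS : Nonempty (StarT k ≃ Bool) ∨ Infinite (StarT k) := by
    by_cases h : k = Cardinal.aleph0
    · left
      have h1 : StarT k = ULift Bool := if_pos h
      rw [h1]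
      exact ⟨Equiv.ulift⟩
    · right
      have h1 : StarT k = DiscT k := if_neg h
      rw [h1]
      exact hDi
  have hSK : (Infinite (QBase k) ∧ Finite (StarT k)) ∨
      (Cardinal.aleph0 < Cardinal.mk (QBase k) ∧
        Cardinal.mk (StarT k) ≤ Cardinal.mk (QBase k)) := by
    by_cases h : k = Cardinal.aleph0
    · left
      have h1 : StarT k = ULift Bool := if_pos h
      rw [h1]
      exact ⟨Cardinal.infinite_iff.2 (hk.trans hle), inferInstance⟩
    · right
      have h1 : StarT k = DiscT k := if_neg h
      rw [h1, hD]
      exact ⟨(lt_of_le_of_ne hk (Ne.symm h)).trans_le hle, hle⟩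
  exact DH.final (S := StarT k) (K := QBase k) hS hν hSK hd₁ hd₂ e₁ e₂
end

section
/- Let k be an infinite cardinal and let F be a nonempty F_σδ-subset of the space B*(k). Then F × Q(k)^ω is homeomorphic to Q(k)^ω, and F is homeomorphic to a closed subset of Q(k)^ω. -/
open Topology Set Filter

universe u v

noncomputable section


/-- A non-archimedean system: a decreasing sequence of equivalence relations whose classes form
neighbourhood bases. -/
structure NASys (X : Type u) [TopologicalSpace X] where
  e : ℕ → X → X → Prop
  refl : ∀ n x, e n x x
  symm : ∀ {n x y}, e n x y → e n y x
  trans : ∀ {n x y z}, e n x y → e n y z → e n x z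
  anti : ∀ {m n x y}, m ≤ n → e n x y → e m x y
  zero : ∀ x y, e 0 x y
  basis : ∀ x, (𝓝 x).HasBasis (fun _ : ℕ => True) (fun n => {y | e n x y})

namespace NASys

variable {X : Type u} [TopologicalSpace X]

def piDisc (T : Type u) [TopologicalSpace T] [DiscreteTopology T] : NASys (ℕ → T) where
  e n x y := ∀ i < n, x i = y i
  refl _ _ _ _ := rfl
  symm h i hi := (h i hi).symm
  trans h h' i hi := (h i hi).trans (h' i hi)
  anti hmn h i hi := h i (hi.trans_le hmn)
  zero _ _ i hi := absurd hi (Nat.not_lt_zero i)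
  basis x := by
    refine ⟨fun s => ⟨fun hs => ?_, ?_⟩⟩
    · rw [nhds_pi, Filter.mem_pi] at hs
      obtain ⟨I, hI, t, ht, hts⟩ := hs
      obtain ⟨n, hn⟩ := hI.bddAbove
      refine ⟨n + 1, trivial, fun y hy => hts fun i hi => ?_⟩
      have := hy i (Nat.lt_succ_of_le (hn hi))
      rw [← this]
      exact mem_of_mem_nhds (ht i)
    · rintro ⟨n, -, h⟩
      refine mem_of_superset ?_ h
      have : {y : ℕ → T | ∀ i < n, x i = y i} = ⋂ i ∈ Finset.range n, {y | x i = y i} := by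
        ext y; simp
      rw [this, Filter.biInter_finset_mem]
      intro i _
      have h2 : {y : ℕ → T | x i = y i} = (fun y : ℕ → T => y i) ⁻¹' {x i} := by
        ext y; simp [eq_comm]
      rw [h2]
      exact ((isOpen_discrete _).preimage (continuous_apply i)).mem_nhds (by simp)

def pi (c : NASys X) : NASys (ℕ → X) where
  e n x y := ∀ i < n, c.e n (x i) (y i)
  refl _ _ _ _ := c.refl _ _
  symm h i hi := c.symm (h i hi)
  trans h h' i hi := c.trans (h i hi) (h' i hi)
  anti hmn h i hi := c.anti hmn (h i (hi.trans_le hmn))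
  zero _ _ i hi := absurd hi (Nat.not_lt_zero i)
  basis x := by
    refine ⟨fun s => ⟨fun hs => ?_, ?_⟩⟩
    · rw [nhds_pi, Filter.mem_pi] at hs
      obtain ⟨I, hI, t, ht, hts⟩ := hs
      have : ∀ i, ∃ n, {y | c.e n (x i) y} ⊆ t i := fun i => by
        obtain ⟨n, -, h⟩ := (c.basis (x i)).mem_iff.1 (ht i)
        exact ⟨n, h⟩
      choose N hN using this
      obtain ⟨n, hn⟩ := hI.bddAbove
      obtain ⟨n', hn'⟩ := (hI.image N).bddAbove
      refine ⟨max (n + 1) n', trivial, fun y hy => hts fun i hi => hN i ?_⟩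
      have h1 := hn hi
      have h2 := hn' (mem_image_of_mem N hi)
      exact c.anti (h2.trans (le_max_right _ _)) (hy i (by
        have := le_max_left (n + 1) n'
        omega))
    · rintro ⟨n, -, h⟩
      refine mem_of_superset ?_ h
      have : {y : ℕ → X | ∀ i < n, c.e n (x i) (y i)}
          = ⋂ i ∈ Finset.range n, {y | c.e n (x i) (y i)} := by
        ext y; simp
      rw [this, Filter.biInter_finset_mem]
      intro i _
      exact (continuous_apply i).continuousAt.preimage_mem_nhds
        ((c.basis (x i)).mem_of_mem (i := n) trivial)

def prod {Y : Type v} [TopologicalSpace Y] (c : NASys X) (d : NASys Y) : NASys (X × Y) where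
  e n x y := c.e n x.1 y.1 ∧ d.e n x.2 y.2
  refl _ _ := ⟨c.refl _ _, d.refl _ _⟩
  symm h := ⟨c.symm h.1, d.symm h.2⟩
  trans h h' := ⟨c.trans h.1 h'.1, d.trans h.2 h'.2⟩
  anti hmn h := ⟨c.anti hmn h.1, d.anti hmn h.2⟩
  zero _ _ := ⟨c.zero _ _, d.zero _ _⟩
  basis x := by
    refine ⟨fun s => ⟨fun hs => ?_, ?_⟩⟩
    · rw [nhds_prod_eq, Filter.mem_prod_iff] at hs
      obtain ⟨t, ht, t', ht', h⟩ := hs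
      obtain ⟨n, -, hn⟩ := (c.basis x.1).mem_iff.1 ht
      obtain ⟨m, -, hm⟩ := (d.basis x.2).mem_iff.1 ht'
      refine ⟨max n m, trivial, fun y hy => h ⟨hn ?_, hm ?_⟩⟩
      · exact c.anti (le_max_left _ _) hy.1
      · exact d.anti (le_max_right _ _) hy.2
    · rintro ⟨n, -, h⟩
      refine mem_of_superset ?_ h
      rw [nhds_prod_eq]
      exact Filter.prod_mem_prod ((c.basis x.1).mem_of_mem (i := n) trivial)
        ((d.basis x.2).mem_of_mem (i := n) trivial)

def induced {Z : Type v} [TopologicalSpace Z] (c : NASys X) (f : Z → X) (hf : IsInducing f) :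
    NASys Z where
  e n x y := c.e n (f x) (f y)
  refl _ _ := c.refl _ _
  symm h := c.symm h
  trans h h' := c.trans h h'
  anti hmn h := c.anti hmn h
  zero _ _ := c.zero _ _
  basis x := by
    rw [hf.nhds_eq_comap]
    exact (c.basis (f x)).comap f

theorem mem_nhds (c : NASys X) (x : X) (n : ℕ) : {y | c.e n x y} ∈ 𝓝 x :=
  (c.basis x).mem_of_mem (i := n) trivial

theorem exists_sub (c : NASys X) {x : X} {s : Set X} (hs : s ∈ 𝓝 x) :
    ∃ n, ∀ y, c.e n x y → y ∈ s := by
  obtain ⟨n, -, h⟩ := (c.basis x).mem_iff.1 hs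
  exact ⟨n, fun y hy => h hy⟩

theorem eq_of_forall [T1Space X] (c : NASys X) {x y : X} (h : ∀ n, c.e n x y) : x = y := by
  by_contra hne
  obtain ⟨n, hn⟩ := c.exists_sub (isOpen_ne.mem_nhds hne)
  exact hn y (h n) rfl

/-- label of a limit point -/
def full (c : NASys X) (z : X) : Set (ℕ × X) := {p | c.e p.1 z p.2}

/-- label of a piece -/
def trunc (c : NASys X) (n : ℕ) (z : X) : Set (ℕ × X) := {p | p.1 ≤ n ∧ c.e p.1 z p.2}

/-- the filter at a limit label -/
def filt (z : X) : Filter (Set (ℕ × X)) := ⨅ m : ℕ, 𝓟 {S | (m, z) ∈ S}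

end NASys

open Classical in
theorem exists_label {X : Type u} {Z : Type v} [TopologicalSpace X] [TopologicalSpace Z] [T1Space Z]
    (E : NASys X) (c : NASys Z) [Nonempty Z] (i : Z → X) (hi : IsClosedEmbedding i)
    (hinterior : interior (range i) = ∅) (U : Set X) (hU : IsOpen U) (hiU : range i ⊆ U) :
    ∃ a : X → Set (ℕ × Z),
      (∀ z, a (i z) = c.full z) ∧
      (∀ x z, a x = c.full z → x = i z) ∧
      (∀ x, (∃ z, x = i z) ∨ ∃ n z, a x = c.trunc n z) ∧
      (∀ n z, ∃ x ∈ U, a x = c.trunc n z) ∧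
      (∀ n z, IsClopen (a ⁻¹' {c.trunc n z})) ∧
      (∀ z, 𝓝 (i z) = comap a (NASys.filt z)) := by
  set near : ℕ → X → Prop := fun n x => ∃ z, E.e n x (i z) with hnear
  have near_anti : ∀ {m n x}, m ≤ n → near n x → near m x :=
    fun hmn ⟨z, hz⟩ => ⟨z, E.anti hmn hz⟩
  have near_i : ∀ n z, near n (i z) := fun n z => ⟨z, E.refl _ _⟩
  have near_congr : ∀ {m n x y}, m ≤ n → E.e n x y → (near m x ↔ near m y) := by
    intro m n x y hmn h
    have h' := E.anti hmn h
    exact ⟨fun ⟨z, hz⟩ => ⟨z, E.trans (E.symm h') hz⟩, fun ⟨z, hz⟩ => ⟨z, E.trans h' hz⟩⟩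
  have far : ∀ x, (∀ z, x ≠ i z) → ∃ n, ¬ near n x := by
    intro x hx
    have : (range i)ᶜ ∈ 𝓝 x := hi.isClosed_range.isOpen_compl.mem_nhds (by
      rintro ⟨z, rfl⟩; exact hx z rfl)
    obtain ⟨n, hn⟩ := E.exists_sub this
    exact ⟨n, fun ⟨z, hz⟩ => hn _ hz ⟨z, rfl⟩⟩
  let z0 : Z := Classical.arbitrary Z
  let pick : Set Z → Z := fun S => if h : S.Nonempty then h.some else z0
  have pick_mem : ∀ S : Set Z, S.Nonempty → pick S ∈ S := fun S h => by
    simp only [pick, dif_pos h]; exact h.some_mem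
  -- the retraction
  obtain ⟨r, r1, r2, r3⟩ : ∃ r : X → Z, (∀ z, r (i z) = z) ∧
      (∀ n x, near n x → E.e n x (i (r x))) ∧
      (∀ x, (∀ z, x ≠ i z) → ∃ n, ¬ near n x ∧ ∀ y, E.e n x y → r y = r x) := by
    refine ⟨fun x => if h : ∃ z, x = i z then h.choose else
      if h' : ∃ n, ¬ near n x then pick {z | E.e (Nat.find h' - 1) x (i z)} else z0, ?_, ?_, ?_⟩
    · intro z
      have h : ∃ z', i z = i z' := ⟨z, rfl⟩
      simp only [dif_pos h]
      exact (hi.injective h.choose_spec).symm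
    · intro n x hn
      by_cases h : ∃ z, x = i z
      · simp only [dif_pos h]
        have := h.choose_spec
        rw [← this]; exact E.refl _ _
      · simp only [dif_neg h]
        have h' : ∃ n, ¬ near n x := far x (by push Not at h; exact h)
        simp only [dif_pos h']
        have hlt : n < Nat.find h' := by
          by_contra hge
          exact Nat.find_spec h' (near_anti (not_lt.1 hge) hn)
        have hne : {z | E.e (Nat.find h' - 1) x (i z)}.Nonempty := by
          have := Nat.find_min h' (m := Nat.find h' - 1) (by omega)
          exact not_not.1 this
        exact E.anti (by omega) (pick_mem _ hne)
    · intro x hx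
      have h' : ∃ n, ¬ near n x := far x hx
      refine ⟨Nat.find h', Nat.find_spec h', fun y hy => ?_⟩
      have hyn : ¬ near (Nat.find h') y := fun h => Nat.find_spec h' ((near_congr le_rfl hy).2 h)
      have hy' : ∀ z, y ≠ i z := by
        rintro z rfl
        exact hyn (near_i _ _)
      have hyf : ∃ n, ¬ near n y := ⟨_, hyn⟩
      have hfind : Nat.find hyf = Nat.find h' := by
        rw [Nat.find_eq_iff]
        refine ⟨hyn, fun m hm => ?_⟩
        have := Nat.find_min h' hm
        rw [not_not] at this ⊢
        exact (near_congr hm.le hy).1 this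
      have hx1 : ¬ ∃ z, x = i z := by push Not; exact hx
      have hy1 : ¬ ∃ z, y = i z := by push Not; exact hy'
      simp only [dif_neg hx1, dif_neg hy1, dif_pos h', dif_pos hyf, hfind]
      congr 1
      ext z
      have hh := E.anti (Nat.sub_le (Nat.find h') 1) hy
      exact ⟨fun h => E.trans hh h, fun h => E.trans (E.symm hh) h⟩
  -- thresholds
  let T : ℕ → Z → ℕ := fun n => Nat.rec (fun _ => 0)
    (fun n Tn z => sInf {m | ∃ x ∈ U, c.e n (r x) z ∧ near (Tn (r x)) x ∧ ¬ near m x}) n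
  have T0 : ∀ z, T 0 z = 0 := fun _ => rfl
  have Tsucc : ∀ n z, T (n + 1) z =
      sInf {m | ∃ x ∈ U, c.e n (r x) z ∧ near (T n (r x)) x ∧ ¬ near m x} := fun _ _ => rfl
  have Tc1 : ∀ n z z', c.e n z z' → T (n + 1) z = T (n + 1) z' := by
    intro n z z' h
    rw [Tsucc, Tsucc]
    congr 1
    ext m
    constructor
    · rintro ⟨x, hx, h1, h2⟩; exact ⟨x, hx, c.trans h1 h, h2⟩
    · rintro ⟨x, hx, h1, h2⟩; exact ⟨x, hx, c.trans h1 (c.symm h), h2⟩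
  have Tc : ∀ n z z', c.e n z z' → T n z = T n z' := by
    intro n z z' h
    cases n with
    | zero => rfl
    | succ n => exact Tc1 n z z' (c.anti (Nat.le_succ n) h)
  have Tex : ∀ n z, ∃ x ∈ U, c.e n (r x) z ∧ near (T n (r x)) x ∧ ¬ near (T (n + 1) z) x := by
    intro n z
    have hne : {m | ∃ x ∈ U, c.e n (r x) z ∧ near (T n (r x)) x ∧ ¬ near m x}.Nonempty := by
      have h1 : {z' | c.e n z z'} ∈ 𝓝 z := c.mem_nhds z n
      rw [hi.isInducing.nhds_eq_comap, mem_comap] at h1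
      obtain ⟨t, ht, hts⟩ := h1
      obtain ⟨N, hN⟩ := E.exists_sub ht
      have h2 : {y | E.e (max N (T n z)) (i z) y} ∩ U ∈ 𝓝 (i z) :=
        inter_mem (E.mem_nhds _ _) (hU.mem_nhds (hiU ⟨z, rfl⟩))
      have h3 : ¬ ({y | E.e (max N (T n z)) (i z) y} ∩ U ⊆ range i) := by
        intro hsub
        have : i z ∈ interior (range i) := mem_interior_iff_mem_nhds.2 (mem_of_superset h2 hsub)
        rw [hinterior] at this; exact this
      obtain ⟨x, ⟨hx1, hx2⟩, hx3⟩ := not_subset.1 h3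
      have hxn : near (max N (T n z)) x := ⟨z, E.symm hx1⟩
      have hr := r2 _ _ hxn
      have hc : c.e n z (r x) := hts (hN _ (E.anti (le_max_left _ _) (E.trans hx1 hr)))
      obtain ⟨m, hm⟩ := far x (fun z hz => hx3 ⟨z, hz.symm⟩)
      refine ⟨m, x, hx2, c.symm hc, ?_, hm⟩
      rw [← Tc n _ _ hc]
      exact near_anti (le_max_right _ _) hxn
    exact Nat.sInf_mem hne
  have Tlt : ∀ n z, T n z < T (n + 1) z := by
    intro n z
    obtain ⟨x, -, h1, h2, h3⟩ := Tex n z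
    by_contra hge
    rw [Tc n _ _ h1] at h2
    exact h3 (near_anti (not_lt.1 hge) h2)
  have Tmono : ∀ z, StrictMono (fun n => T n z) := fun z => strictMono_nat_of_lt_succ (fun n => Tlt n z)
  have Tge : ∀ n z, n ≤ T n z := fun n z => (Tmono z).id_le n
  let lvl : ℕ → X → Prop := fun n x => near (T n (r x)) x
  have lvl_anti : ∀ {m n x}, m ≤ n → lvl n x → lvl m x :=
    fun hmn h => near_anti ((Tmono _).monotone hmn) h
  have lvl0 : ∀ x, lvl 0 x := fun x => ⟨z0, E.zero _ _⟩
  have lvl_i : ∀ n z, lvl n (i z) := fun n z => near_i _ _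
  have lvl_far : ∀ x, (∀ z, x ≠ i z) → ∃ n, ¬ lvl n x := by
    intro x hx
    obtain ⟨n, hn⟩ := far x hx
    exact ⟨n, fun h => hn (near_anti (Tge _ _) h)⟩
  let a : X → Set (ℕ × Z) := fun x => {p | lvl p.1 x ∧ c.e p.1 (r x) p.2}
  have ha : ∀ x p, p ∈ a x ↔ lvl p.1 x ∧ c.e p.1 (r x) p.2 := fun _ _ => Iff.rfl
  have trunc_congr : ∀ n z z', c.e n z z' → c.trunc n z = c.trunc n z' := by
    intro n z z' h
    ext ⟨m, w⟩
    simp only [NASys.trunc, mem_ofPred_eq]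
    refine and_congr_right fun hm => ?_
    have := c.anti hm h
    exact ⟨fun h => c.trans (c.symm this) h, fun h => c.trans this h⟩
  have a_trunc : ∀ x n, lvl n x → ¬ lvl (n + 1) x → a x = c.trunc n (r x) := by
    intro x n h1 h2
    ext ⟨m, w⟩
    simp only [NASys.trunc, mem_ofPred_eq, ha]
    refine and_congr_left fun _ => ⟨fun h => ?_, fun h => lvl_anti h h1⟩
    by_contra hm
    exact h2 (lvl_anti (Nat.succ_le_of_lt (not_le.1 hm)) h)
  have P1 : ∀ z, a (i z) = c.full z := by
    intro z
    ext ⟨m, w⟩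
    simp [NASys.full, ha, r1, lvl_i]
  have P6 : ∀ z, 𝓝 (i z) = comap a (NASys.filt z) := by
    intro z
    have hcm : comap a (NASys.filt z) = ⨅ m : ℕ, 𝓟 {x | lvl m x ∧ c.e m (r x) z} := by
      simp only [NASys.filt, comap_iInf, comap_principal]
      rfl
    rw [hcm]
    apply le_antisymm
    · refine le_iInf fun m => ?_
      rw [le_principal_iff]
      have h1 : {z' | c.e m z z'} ∈ 𝓝 z := c.mem_nhds z m
      rw [hi.isInducing.nhds_eq_comap, mem_comap] at h1
      obtain ⟨t, ht, hts⟩ := h1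
      obtain ⟨N, hN⟩ := E.exists_sub ht
      refine mem_of_superset (E.mem_nhds (i z) (max N (T m z))) fun x hx1 => ?_
      have hxn : near (max N (T m z)) x := ⟨z, E.symm hx1⟩
      have hr := r2 _ _ hxn
      have hc : c.e m z (r x) := hts (hN _ (E.anti (le_max_left _ _) (E.trans hx1 hr)))
      refine ⟨?_, c.symm hc⟩
      show near _ _
      rw [← Tc m _ _ hc]
      exact near_anti (le_max_right _ _) hxn
    · intro s hs
      obtain ⟨N, hN⟩ := E.exists_sub hs
      have h1 : {x | E.e N (i z) x} ∈ 𝓝 (i z) := E.mem_nhds (i z) N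
      have h2 := hi.continuous.continuousAt.preimage_mem_nhds h1
      obtain ⟨M, hM⟩ := c.exists_sub h2
      refine mem_iInf_of_mem (max N M) ?_
      rw [mem_principal]
      rintro x ⟨hx1, hx2⟩
      have h3 : E.e N (i z) (i (r x)) := hM _ (c.symm (c.anti (le_max_right _ _) hx2))
      have h4 : near N x := near_anti ((le_max_left N M).trans (Tge _ _)) hx1
      exact hN _ (E.trans h3 (E.symm (r2 _ _ h4)))
  have loc : ∀ x, (∀ z, x ≠ i z) → ∀ᶠ y in 𝓝 x, a y = a x := by
    intro x hx
    obtain ⟨n, hn, hr⟩ := r3 x hx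
    filter_upwards [E.mem_nhds x n] with y hy
    have hry := hr y hy
    ext ⟨m, w⟩
    simp only [ha, hry]
    refine and_congr_left fun _ => ?_
    show near (T m (r y)) y ↔ near (T m (r x)) x
    rw [hry]
    rcases le_or_gt (T m (r x)) n with hm | hm
    · exact (near_congr hm hy).symm
    · have h1 : ¬ near (T m (r x)) x := fun h => hn (near_anti hm.le h)
      have h2 : ¬ near (T m (r x)) y := fun h =>
        hn ((near_congr le_rfl hy).2 (near_anti hm.le h))
      exact ⟨fun h => absurd h h2, fun h => absurd h h1⟩
  have near_trunc : ∀ z n w, ∀ᶠ y in 𝓝 (i z), a y ≠ c.trunc n w := by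
    intro z n w
    rw [P6 z]
    have h1 : {S : Set (ℕ × Z) | (n + 1, z) ∈ S} ∈ NASys.filt z :=
      mem_iInf_of_mem (n + 1) (mem_principal_self _)
    filter_upwards [preimage_mem_comap h1] with y hy heq
    have hy' : (n + 1, z) ∈ a y := hy
    rw [heq] at hy'
    have := hy'.1
    simp at this
  have not_i_of_trunc : ∀ x n w, a x = c.trunc n w → ∀ z, x ≠ i z := by
    rintro x n w h z rfl
    exact (near_trunc z n w).self_of_nhds h
  refine ⟨a, P1, ?_, ?_, ?_, ?_, P6⟩
  · intro x z h
    have hall : ∀ n, lvl n x ∧ c.e n (r x) z := fun n => by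
      have : (n, z) ∈ a x := by rw [h]; exact c.refl _ _
      exact this
    by_contra hne
    have hx : ∀ z', x ≠ i z' := by
      intro z' hz'
      have := c.eq_of_forall (fun n => (hall n).2)
      apply hne
      rw [← this, hz', r1]
    obtain ⟨n, hn⟩ := lvl_far x hx
    exact hn (hall n).1
  · intro x
    by_cases h : ∃ z, x = i z
    · exact Or.inl h
    · right
      push Not at h
      have hf := lvl_far x h
      have h0 : Nat.find hf ≠ 0 := fun h0 => by
        have := Nat.find_spec hf
        rw [h0] at this
        exact this (lvl0 x)
      refine ⟨Nat.find hf - 1, r x, a_trunc x _ ?_ ?_⟩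
      · exact not_not.1 (Nat.find_min hf (m := Nat.find hf - 1) (by omega))
      · rw [Nat.sub_add_cancel (by omega)]
        exact Nat.find_spec hf
  · intro n z
    obtain ⟨x, hxU, h1, h2, h3⟩ := Tex n z
    refine ⟨x, hxU, ?_⟩
    rw [← trunc_congr _ _ _ h1]
    apply a_trunc x n h2
    show ¬ near (T (n + 1) (r x)) x
    rw [Tc1 n _ _ h1]
    exact h3
  · intro n w
    constructor
    · rw [← isOpen_compl_iff, isOpen_iff_mem_nhds]
      intro x hx
      by_cases h : ∃ z, x = i z
      · obtain ⟨z, rfl⟩ := h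
        exact near_trunc z n w
      · push Not at h
        filter_upwards [loc x h] with y hy hy'
        exact hx (by simpa [hy] using hy')
    · rw [isOpen_iff_mem_nhds]
      intro x hx
      filter_upwards [loc x (not_i_of_trunc x n w hx)] with y hy
      show a y = _
      rw [hy]; exact hx

section Stages

variable {X Y : Type u} [TopologicalSpace X] [TopologicalSpace Y]

/-- Inside the box `U × V`, the label `m` has singleton fibres, with matching neighbourhoods. -/
def LDone (U : Set X) (V : Set Y) {L : Type u} (a : X → L) (b : Y → L) (m : L) : Prop :=
  ∃ x y, U ∩ a ⁻¹' {m} = {x} ∧ V ∩ b ⁻¹' {m} = {y} ∧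
    ∃ G : Filter L, 𝓝 x = comap a G ∧ 𝓝 y = comap b G

/-- Inside the box `U × V`, the label `m` has nonempty clopen fibres. -/
def LOpn (U : Set X) (V : Set Y) {L : Type u} (a : X → L) (b : Y → L) (m : L) : Prop :=
  IsClopen (U ∩ a ⁻¹' {m}) ∧ (U ∩ a ⁻¹' {m}).Nonempty ∧
  IsClopen (V ∩ b ⁻¹' {m}) ∧ (V ∩ b ⁻¹' {m}).Nonempty

def LEmp (U : Set X) (V : Set Y) {L : Type u} (a : X → L) (b : Y → L) (m : L) : Prop :=
  U ∩ a ⁻¹' {m} = ∅ ∧ V ∩ b ⁻¹' {m} = ∅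

def LOk (U : Set X) (V : Set Y) {L : Type u} (a : X → L) (b : Y → L) (m : L) : Prop :=
  LDone U V a b m ∨ LOpn U V a b m ∨ LEmp U V a b m

theorem LDone.swap {U : Set X} {V : Set Y} {L : Type u} {a : X → L} {b : Y → L} {m : L}
    (h : LDone U V a b m) : LDone V U b a m := by
  obtain ⟨x, y, h1, h2, G, h3, h4⟩ := h
  exact ⟨y, x, h2, h1, G, h4, h3⟩

theorem LOk.swap {U : Set X} {V : Set Y} {L : Type u} {a : X → L} {b : Y → L} {m : L}
    (h : LOk U V a b m) : LOk V U b a m := by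
  rcases h with h | ⟨h1, h2, h3, h4⟩ | ⟨h1, h2⟩
  · exact Or.inl h.swap
  · exact Or.inr (Or.inl ⟨h3, h4, h1, h2⟩)
  · exact Or.inr (Or.inr ⟨h2, h1⟩)

theorem local_step [T2Space X] (E : NASys X) (D : NASys Y)
    (U : Set X) (V : Set Y) (hU : IsClopen U) (hV : IsClopen V) (hUn : U.Nonempty)
    (hVn : V.Nonempty) (C : Set X) (hC : IsClosed C) (hCi : interior C = ∅)
    (g : X → Y) (hg : IsClosedEmbedding g) (hgV : range g ⊆ V) (hgi : interior (range g) = ∅) :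
    ∃ (L : Type u) (a : X → L) (b : Y → L), (∀ m, LOk U V a b m) ∧
      ∀ x ∈ C ∩ U, LDone U V a b (a x) := by
  by_cases hne : (C ∩ U).Nonempty
  swap
  · refine ⟨PUnit, fun _ => PUnit.unit, fun _ => PUnit.unit, fun m => ?_, ?_⟩
    · right; left
      refine ⟨?_, ?_, ?_, ?_⟩ <;> simpa [LOpn]
    · intro x hx
      exact absurd ⟨x, hx⟩ hne
  · have hcl : IsClosed (C ∩ U) := hC.inter hU.1
    have : Nonempty ↥(C ∩ U) := hne.to_subtype
    have hemb : IsClosedEmbedding (Subtype.val : ↥(C ∩ U) → X) := hcl.isClosedEmbedding_subtypeVal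
    let c : NASys ↥(C ∩ U) := E.induced Subtype.val hemb.isInducing
    have hj : IsClosedEmbedding (g ∘ (Subtype.val : ↥(C ∩ U) → X)) := hg.comp hemb
    obtain ⟨a, a1, a2, a3, a4, a5, a6⟩ := exists_label E c Subtype.val hemb
      (by
        rw [← subset_empty_iff, ← hCi]
        exact interior_mono (by rintro _ ⟨z, rfl⟩; exact z.2.1)) U hU.2
      (by rintro _ ⟨z, rfl⟩; exact z.2.2)
    obtain ⟨b, b1, b2, b3, b4, b5, b6⟩ := exists_label D c (g ∘ Subtype.val) hj
      (by
        rw [← subset_empty_iff, ← hgi]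
        exact interior_mono (by rintro _ ⟨z, rfl⟩; exact ⟨_, rfl⟩)) V hV.2
      (by rintro _ ⟨z, rfl⟩; exact hgV ⟨_, rfl⟩)
    have hdone : ∀ z, LDone U V a b (c.full z) := by
      intro z
      refine ⟨z.1, g z.1, ?_, ?_, NASys.filt z, a6 z, b6 z⟩
      · ext x
        constructor
        · rintro ⟨-, hx⟩; exact a2 x z hx
        · rintro rfl; exact ⟨z.2.2, a1 z⟩
      · ext y
        constructor
        · rintro ⟨-, hy⟩; exact b2 y z hy
        · rintro rfl; exact ⟨hgV ⟨_, rfl⟩, b1 z⟩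
    have hopn : ∀ n z, LOpn U V a b (c.trunc n z) := by
      intro n z
      refine ⟨hU.inter (a5 n z), a4 n z, hV.inter (b5 n z), b4 n z⟩
    refine ⟨Set (ℕ × ↥(C ∩ U)), a, b, fun m => ?_, ?_⟩
    · by_cases h : (∃ z, m = c.full z) ∨ ∃ n z, m = c.trunc n z
      · rcases h with ⟨z, rfl⟩ | ⟨n, z, rfl⟩
        · exact Or.inl (hdone z)
        · exact Or.inr (Or.inl (hopn n z))
      · right; right
        push Not at h
        constructor
        · rw [eq_empty_iff_forall_notMem]
          rintro x ⟨-, hx⟩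
          have hx : a x = m := hx
          rcases a3 x with ⟨z, rfl⟩ | ⟨n, z, hz⟩
          · exact h.1 z (by rw [← hx, a1])
          · exact h.2 n z (by rw [← hx, hz])
        · rw [eq_empty_iff_forall_notMem]
          rintro x ⟨-, hx⟩
          have hx : b x = m := hx
          rcases b3 x with ⟨z, rfl⟩ | ⟨n, z, hz⟩
          · exact h.1 z (by rw [← hx, b1])
          · exact h.2 n z (by rw [← hx, hz])
    · intro x hx
      have := a1 ⟨x, hx⟩
      rw [show a x = _ from this]
      exact hdone _

variable (X Y) in
structure BFStage where
  L : Type u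
  a : X → L
  b : Y → L
  ok : ∀ l, LOk univ univ a b l

namespace BFStage

def swap (s : BFStage X Y) : BFStage Y X := ⟨s.L, s.b, s.a, fun l => (s.ok l).swap⟩

def Done (s : BFStage X Y) (l : s.L) : Prop := LDone univ univ s.a s.b l

def Ref (s t : BFStage X Y) : Prop :=
  ∃ π : t.L → s.L, (∀ x, π (t.a x) = s.a x) ∧ (∀ y, π (t.b y) = s.b y)

theorem Ref.trans {s t w : BFStage X Y} (h : s.Ref t) (h' : t.Ref w) : s.Ref w := by
  obtain ⟨π, h1, h2⟩ := h
  obtain ⟨ρ, h3, h4⟩ := h'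
  exact ⟨π ∘ ρ, fun x => by simp [h3, h1], fun x => by simp [h4, h2]⟩

theorem Ref.swap {s t : BFStage X Y} (h : s.Ref t) : s.swap.Ref t.swap := by
  obtain ⟨π, h1, h2⟩ := h
  exact ⟨π, h2, h1⟩

theorem exists_y (s : BFStage X Y) (x : X) : ∃ y, s.b y = s.a x := by
  rcases s.ok (s.a x) with ⟨x', y, h1, h2, -⟩ | ⟨-, -, -, y, hy⟩ | ⟨h, -⟩
  · have : y ∈ univ ∩ s.b ⁻¹' {s.a x} := by rw [h2]; rfl
    exact ⟨y, this.2⟩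
  · exact ⟨y, hy.2⟩
  · exact absurd (show x ∈ univ ∩ s.a ⁻¹' {s.a x} by simp) (by rw [h]; simp)

theorem Done.of_ref {s t : BFStage X Y} (h : s.Ref t) {x : X} (hd : s.Done (s.a x)) :
    t.Done (t.a x) := by
  obtain ⟨π, p1, p2⟩ := h
  obtain ⟨x', y, h1, h2, G, h3, h4⟩ := hd
  have hx : ∀ w, s.a w = s.a x → w = x' := fun w hw => by
    have : w ∈ univ ∩ s.a ⁻¹' {s.a x} := ⟨trivial, hw⟩
    rw [h1] at this; exact this
  have hy : ∀ w, s.b w = s.a x → w = y := fun w hw => by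
    have : w ∈ univ ∩ s.b ⁻¹' {s.a x} := ⟨trivial, hw⟩
    rw [h2] at this; exact this
  obtain rfl : x = x' := hx x rfl
  obtain ⟨y', hy'⟩ := t.exists_y x
  obtain rfl : y' = y := hy y' (by rw [← p2, hy', p1])
  refine ⟨x, y', ?_, ?_, comap π G, ?_, ?_⟩
  · ext w
    constructor
    · rintro ⟨-, hw⟩
      have hw : t.a w = t.a x := hw
      exact hx w (by rw [← p1, hw, p1])
    · rintro rfl; exact ⟨trivial, rfl⟩
  · ext w
    constructor
    · rintro ⟨-, hw⟩
      have hw : t.b w = t.a x := hw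
      exact hy w (by rw [← p2, hw, p1])
    · rintro rfl; exact ⟨trivial, hy'⟩
  · rw [h3, comap_comap]; congr 1; funext w; exact (p1 w).symm
  · rw [h4, comap_comap]; congr 1; funext w; exact (p2 w).symm

end BFStage

theorem nhds_sigma_aux {W L : Type u} [TopologicalSpace W] {K : L → Type u} (a : W → L)
    (f : ∀ l, W → K l) (l : L) (hopen : IsOpen (a ⁻¹' {l})) (x : W) (hx : a x = l)
    (G : Filter (K l)) (h : 𝓝 x = comap (f l) G) :
    𝓝 x = comap (fun w => (⟨a w, f (a w) w⟩ : Σ l, K l)) (map (Sigma.mk l) G) := by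
  ext s
  rw [mem_comap]
  constructor
  · intro hs
    have h1 : s ∈ comap (f l) G := h ▸ hs
    obtain ⟨t, ht, hts⟩ := mem_comap.1 h1
    refine ⟨Sigma.mk l '' t, image_mem_map ht, ?_⟩
    rintro w ⟨k, hk, hw⟩
    obtain ⟨h2, h3⟩ := Sigma.mk.inj_iff.1 hw
    subst h2
    have h3 := eq_of_heq h3
    apply hts
    show f _ w ∈ t
    rw [← h3]; exact hk
  · rintro ⟨t, ht, hts⟩
    have h1 : (f l) ⁻¹' (Sigma.mk l ⁻¹' t) ∈ 𝓝 x := by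
      rw [h]; exact preimage_mem_comap ht
    filter_upwards [h1, hopen.mem_nhds hx] with w hw hw2
    apply hts
    have hw2 : a w = l := hw2
    subst hw2
    exact hw

theorem half_step [T2Space X] (E : NASys X) (D : NASys Y) (C : Set X) (hC : IsClosed C)
    (hCi : interior C = ∅)
    (hemb : ∀ V : Set Y, IsOpen V → V.Nonempty → ∃ g : X → Y, IsClosedEmbedding g ∧ range g ⊆ V ∧
      interior (range g) = ∅)
    (s : BFStage X Y) : ∃ t : BFStage X Y, s.Ref t ∧ ∀ x ∈ C, t.Done (t.a x) := by
  have key : ∀ l : s.L, ∃ (L : Type u) (a : X → L) (b : Y → L),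
      (LOpn univ univ s.a s.b l → (∀ m, LOk (s.a ⁻¹' {l}) (s.b ⁻¹' {l}) a b m) ∧
        ∀ x ∈ C ∩ s.a ⁻¹' {l}, LDone (s.a ⁻¹' {l}) (s.b ⁻¹' {l}) a b (a x)) ∧
      (¬ LOpn univ univ s.a s.b l → Subsingleton L) := by
    intro l
    by_cases h : LOpn univ univ s.a s.b l
    · have h' := h
      obtain ⟨h1, h2, h3, h4⟩ := h'
      rw [univ_inter] at h1 h2 h3 h4
      obtain ⟨g, g1, g2, g3⟩ := hemb _ h3.2 h4
      obtain ⟨L, a, b, hab⟩ := local_step E D _ _ h1 h3 h2 h4 C hC hCi g g1 g2 g3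
      exact ⟨L, a, b, fun _ => hab, fun hn => absurd h hn⟩
    · exact ⟨PUnit, fun _ => PUnit.unit, fun _ => PUnit.unit, fun h' => absurd h' h,
        fun _ => inferInstance⟩
  choose K f g hO hN using key
  let a' : X → Σ l, K l := fun x => ⟨s.a x, f (s.a x) x⟩
  let b' : Y → Σ l, K l := fun x => ⟨s.b x, g (s.b x) x⟩
  have fa : ∀ l (m : K l), a' ⁻¹' {⟨l, m⟩} = s.a ⁻¹' {l} ∩ f l ⁻¹' {m} := by
    intro l m
    ext x
    constructor
    · intro hx
      obtain ⟨h2, h3⟩ := Sigma.mk.inj_iff.1 (show a' x = ⟨l, m⟩ from hx)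
      subst h2
      exact ⟨rfl, eq_of_heq h3⟩
    · rintro ⟨h1, h2⟩
      have h1 : s.a x = l := h1
      subst h1
      have h2 : f _ x = m := h2
      subst h2
      rfl
  have fb : ∀ l (m : K l), b' ⁻¹' {⟨l, m⟩} = s.b ⁻¹' {l} ∩ g l ⁻¹' {m} := by
    intro l m
    ext x
    constructor
    · intro hx
      obtain ⟨h2, h3⟩ := Sigma.mk.inj_iff.1 (show b' x = ⟨l, m⟩ from hx)
      subst h2
      exact ⟨rfl, eq_of_heq h3⟩
    · rintro ⟨h1, h2⟩
      have h1 : s.b x = l := h1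
      subst h1
      have h2 : g _ x = m := h2
      subst h2
      rfl
  have hdone : ∀ l (m : K l), LOpn univ univ s.a s.b l →
      LDone (s.a ⁻¹' {l}) (s.b ⁻¹' {l}) (f l) (g l) m → LDone univ univ a' b' ⟨l, m⟩ := by
    rintro l m ⟨o1, -, o2, -⟩ ⟨x, y, h1, h2, G, h3, h4⟩
    rw [univ_inter] at o1 o2
    have hx : x ∈ s.a ⁻¹' {l} ∩ f l ⁻¹' {m} := by rw [h1]; rfl
    have hy : y ∈ s.b ⁻¹' {l} ∩ g l ⁻¹' {m} := by rw [h2]; rfl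
    refine ⟨x, y, by rw [univ_inter, fa, h1], by rw [univ_inter, fb, h2], map (Sigma.mk l) G, ?_, ?_⟩
    · exact nhds_sigma_aux s.a f l o1.2 x hx.1 G h3
    · exact nhds_sigma_aux s.b g l o2.2 y hy.1 G h4
  have hdone2 : ∀ l (m : K l), ¬ LOpn univ univ s.a s.b l →
      LDone univ univ s.a s.b l → LDone univ univ a' b' ⟨l, m⟩ := by
    rintro l m hno ⟨x, y, h1, h2, G, h3, h4⟩
    have := hN l hno
    have e1 : f l ⁻¹' {m} = univ := by ext w; simp [eq_iff_true_of_subsingleton]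
    have e2 : g l ⁻¹' {m} = univ := by ext w; simp [eq_iff_true_of_subsingleton]
    refine ⟨x, y, ?_, ?_, comap Sigma.fst G, ?_, ?_⟩
    · rw [fa, e1, inter_univ, h1]
    · rw [fb, e2, inter_univ, h2]
    · rw [h3, comap_comap]; rfl
    · rw [h4, comap_comap]; rfl
  refine ⟨⟨Σ l, K l, a', b', ?_⟩, ⟨Sigma.fst, fun _ => rfl, fun _ => rfl⟩, ?_⟩
  · rintro ⟨l, m⟩
    by_cases hl : LOpn univ univ s.a s.b l
    · rcases (hO l hl).1 m with h | h | h
      · exact Or.inl (hdone l m hl h)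
      · right; left
        simpa only [LOpn, univ_inter, fa, fb] using h
      · right; right
        simpa only [LEmp, univ_inter, fa, fb] using h
    · rcases s.ok l with h | h | h
      · exact Or.inl (hdone2 l m hl h)
      · exact absurd h hl
      · right; right
        obtain ⟨h1, h2⟩ := h
        rw [univ_inter] at h1 h2
        simp only [LEmp, univ_inter, fa, fb, h1, h2, empty_inter, and_self]
  · intro x hx
    show LDone univ univ a' b' ⟨s.a x, f (s.a x) x⟩
    by_cases hl : LOpn univ univ s.a s.b (s.a x)
    · exact hdone _ _ hl ((hO _ hl).2 x ⟨hx, rfl⟩)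
    · rcases s.ok (s.a x) with h | h | h
      · exact hdone2 _ _ hl h
      · exact absurd h hl
      · exact absurd (show x ∈ univ ∩ s.a ⁻¹' {s.a x} by simp) (by rw [h.1]; simp)

/-- Uniqueness theorem of Knaster–Reichbach type. -/
theorem homeo_of_embeddings [T2Space X] [T2Space Y] [Nonempty X] [Nonempty Y]
    (E : NASys X) (D : NASys Y)
    (C : ℕ → Set X) (hC : ∀ n, IsClosed (C n)) (hCi : ∀ n, interior (C n) = ∅)
    (hCu : ∀ x, ∃ n, x ∈ C n)
    (B : ℕ → Set Y) (hB : ∀ n, IsClosed (B n)) (hBi : ∀ n, interior (B n) = ∅)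
    (hBu : ∀ x, ∃ n, x ∈ B n)
    (hXY : ∀ V : Set Y, IsOpen V → V.Nonempty → ∃ g : X → Y, IsClosedEmbedding g ∧ range g ⊆ V ∧
      interior (range g) = ∅)
    (hYX : ∀ V : Set X, IsOpen V → V.Nonempty → ∃ g : Y → X, IsClosedEmbedding g ∧ range g ⊆ V ∧
      interior (range g) = ∅) : Nonempty (X ≃ₜ Y) := by
  have step : ∀ (n : ℕ) (s : BFStage X Y), ∃ t : BFStage X Y, s.Ref t ∧
      (∀ x ∈ C n, t.Done (t.a x)) ∧ (∀ y ∈ B n, t.Done (t.b y)) := by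
    intro n s
    obtain ⟨t, h1, h2⟩ := half_step E D (C n) (hC n) (hCi n) hXY s
    obtain ⟨w, h3, h4⟩ := half_step D E (B n) (hB n) (hBi n) hYX t.swap
    have h5 : t.Ref w.swap := h3.swap
    exact ⟨w.swap, h1.trans h5, fun x hx => (h2 x hx).of_ref h5, fun y hy => (h4 y hy).swap⟩
  choose nxt n1 n2 n3 using step
  let s0 : BFStage X Y := ⟨PUnit, fun _ => PUnit.unit, fun _ => PUnit.unit, fun m => by
    right; left
    refine ⟨?_, ?_, ?_, ?_⟩ <;> simp [isClopen_univ]⟩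
  let S : ℕ → BFStage X Y := fun n => Nat.rec s0 (fun n s => nxt n s) n
  have hS : ∀ n, S (n + 1) = nxt n (S n) := fun _ => rfl
  have hR1 : ∀ n, (S n).Ref (S (n + 1)) := fun n => n1 n (S n)
  have hR : ∀ m n, m ≤ n → (S m).Ref (S n) := by
    intro m n h
    induction n, h using Nat.le_induction with
    | base => exact ⟨id, fun _ => rfl, fun _ => rfl⟩
    | succ n _ ih => exact ih.trans (hR1 n)
  have dX : ∀ x, ∃ n, (S n).Done ((S n).a x) := fun x => by
    obtain ⟨n, hn⟩ := hCu x
    exact ⟨n + 1, n2 n (S n) x hn⟩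
  have dY : ∀ y, ∃ n, (S n).Done ((S n).b y) := fun y => by
    obtain ⟨n, hn⟩ := hBu y
    exact ⟨n + 1, n3 n (S n) y hn⟩
  -- existence, for a general sequence
  have gen : ∀ {X' Y' : Type u} [TopologicalSpace X'] [TopologicalSpace Y'] (S : ℕ → BFStage X' Y')
      (_ : ∀ m n, m ≤ n → (S m).Ref (S n)) (x : X') (n : ℕ) (_ : (S n).Done ((S n).a x)),
      ∃ y, ∀ m, (S m).a x = (S m).b y := by
    intro X' Y' _ _ S hR x n hd
    obtain ⟨x', y, h1, h2, -⟩ := hd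
    have hy : ∀ w, (S n).b w = (S n).a x → w = y := fun w hw => by
      have : w ∈ univ ∩ (S n).b ⁻¹' {(S n).a x} := ⟨trivial, hw⟩
      rw [h2] at this; exact this
    refine ⟨y, fun m => ?_⟩
    obtain ⟨y', hy'⟩ := (S (max m n)).exists_y x
    obtain ⟨π, p1, p2⟩ := hR n _ (le_max_right m n)
    obtain ⟨ρ, q1, q2⟩ := hR m _ (le_max_left m n)
    obtain rfl := hy y' (by rw [← p1, ← p2, hy'])
    rw [← q1, ← q2, hy']
  have exY : ∀ x, ∃ y, ∀ m, (S m).a x = (S m).b y := fun x => by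
    obtain ⟨n, hn⟩ := dX x
    exact gen S hR x n hn
  have exX : ∀ y, ∃ x, ∀ m, (S m).b y = (S m).a x := fun y => by
    obtain ⟨n, hn⟩ := dY y
    exact gen (fun n => (S n).swap) (fun m n h => (hR m n h).swap) y n hn.swap
  choose f hf using exY
  choose g hg using exX
  have uX : ∀ x x', (∀ m, (S m).a x = (S m).a x') → x = x' := by
    intro x x' h
    obtain ⟨n, p, q, h1, -⟩ := dX x
    have e1 : x ∈ univ ∩ (S n).a ⁻¹' {(S n).a x} := ⟨trivial, rfl⟩
    have e2 : x' ∈ univ ∩ (S n).a ⁻¹' {(S n).a x} := ⟨trivial, (h n).symm⟩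
    rw [h1] at e1 e2
    rw [mem_singleton_iff.1 e1, mem_singleton_iff.1 e2]
  have uY : ∀ x x', (∀ m, (S m).b x = (S m).b x') → x = x' := by
    intro x x' h
    obtain ⟨n, p, q, -, h1, -⟩ := dY x
    have e1 : x ∈ univ ∩ (S n).b ⁻¹' {(S n).b x} := ⟨trivial, rfl⟩
    have e2 : x' ∈ univ ∩ (S n).b ⁻¹' {(S n).b x} := ⟨trivial, (h n).symm⟩
    rw [h1] at e1 e2
    rw [mem_singleton_iff.1 e1, mem_singleton_iff.1 e2]
  let e : X ≃ Y :=
    { toFun := f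
      invFun := g
      left_inv := fun x => uX _ _ fun m => by rw [← hg, ← hf]
      right_inv := fun y => uY _ _ fun m => by rw [← hf, ← hg] }
  refine ⟨e.toHomeomorphOfIsInducing ⟨?_⟩⟩
  apply TopologicalSpace.ext_nhds
  intro x
  rw [nhds_induced]
  obtain ⟨n, p, q, h1, h2, G, h3, h4⟩ := dX x
  have e1 : x ∈ univ ∩ (S n).a ⁻¹' {(S n).a x} := ⟨trivial, rfl⟩
  have e2 : f x ∈ univ ∩ (S n).b ⁻¹' {(S n).a x} := ⟨trivial, (hf x n).symm⟩
  rw [h1] at e1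
  rw [h2] at e2
  have e1 : x = p := e1
  have e2 : f x = q := e2
  subst e1
  have h5 : 𝓝 (f x) = comap (S n).b G := by rw [e2, h4]
  show 𝓝 x = comap f (𝓝 (f x))
  rw [h3, h5, comap_comap]
  congr 1
  funext w
  exact hf w n

end Stages

section Application

variable (k : Cardinal.{u})

/-- the base point -/
def qz : QBase k := Sum.inr PUnit.unit

/-- the other points -/
def qi {k : Cardinal.{u}} (v : DiscT k) : QBase k := Sum.inl v

theorem qi_ne (v : DiscT k) : qi v ≠ qz k := by
  intro h
  cases h

theorem qi_injective : Function.Injective (qi (k := k)) := Sum.inl_injective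

def Qk.toFun {k : Cardinal.{u}} (q : Qk k) : ℕ → QBase k := q.1

theorem Qk.isEmbedding : IsEmbedding (Qk.toFun (k := k)) := IsEmbedding.subtypeVal

instance : T2Space (Qk k) := (Qk.isEmbedding k).t2Space

instance : T2Space (QkOmega k) := inferInstanceAs (T2Space (ℕ → Qk k))

instance : T2Space (BaireStar k) := inferInstanceAs (T2Space (ℕ → StarT k))

def Qk.ofFun {k : Cardinal.{u}} (x : ℕ → QBase k)
    (h : ∀ᶠ n in Filter.atTop, x n = qz k) : Qk k := ⟨x, h⟩

instance : Nonempty (Qk k) := ⟨Qk.ofFun (fun _ => qz k) (Eventually.of_forall fun _ => rfl)⟩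

instance : Nonempty (QkOmega k) := inferInstanceAs (Nonempty (ℕ → Qk k))

def naQk : NASys (Qk k) := (NASys.piDisc (QBase k)).induced Qk.toFun (Qk.isEmbedding k).isInducing

def naQkOmega : NASys (QkOmega k) := (naQk k).pi

def naBaireStar : NASys (BaireStar k) := NASys.piDisc (StarT k)

/-- The closed discrete layers of `Q(k)`. -/
def layer (n : ℕ) : Set (Qk k) := {q | ∀ m ≥ n, q.toFun m = qz k}

theorem continuous_toFun_apply (m : ℕ) : Continuous fun q : Qk k => q.toFun m :=
  (continuous_apply m).comp (Qk.isEmbedding k).continuous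

theorem isClosed_layer (n : ℕ) : IsClosed (layer k n) := by
  have : layer k n = ⋂ m ≥ n, (fun q : Qk k => q.toFun m) ⁻¹' {qz k} := by
    ext q; simp [layer]
  rw [this]
  exact isClosed_biInter fun m _ => (isClosed_discrete _).preimage (continuous_toFun_apply k m)

theorem exists_layer (q : Qk k) : ∃ n, q ∈ layer k n := by
  obtain ⟨n, hn⟩ := eventually_atTop.1 q.2
  exact ⟨n, hn⟩

theorem exists_not_layer [Nonempty (DiscT k)] (n : ℕ) (q : Qk k) (s : Set (Qk k)) (hs : s ∈ 𝓝 q) :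
    ∃ p ∈ s, p ∉ layer k n := by
  obtain ⟨N, hN⟩ := (naQk k).exists_sub hs
  let v : DiscT k := Classical.arbitrary _
  classical
  refine ⟨Qk.ofFun (Function.update q.toFun (max N n) (qi v)) ?_, hN _ ?_, ?_⟩
  · filter_upwards [q.2, eventually_gt_atTop (max N n)] with m hm hm2
    rw [Function.update_of_ne hm2.ne']
    exact hm
  · intro i hi
    show q.toFun i = Function.update q.toFun (max N n) (qi v) i
    rw [Function.update_of_ne]
    have := le_max_left N n
    omega
  · intro h
    have h1 := h (max N n) (le_max_right _ _)
    have h2 : Function.update q.toFun (max N n) (qi v) (max N n) = qz k := h1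
    rw [Function.update_self] at h2
    exact qi_ne k v h2

/-- preimages of layers under an open surjection-like coordinate have empty interior -/
theorem interior_layer [Nonempty (DiscT k)] {W : Type u} [TopologicalSpace W] (p : W → Qk k)
    (hp : IsOpenMap p) (n : ℕ) (A : Set W) (hA : A ⊆ p ⁻¹' layer k n) : interior A = ∅ := by
  rw [eq_empty_iff_forall_notMem]
  intro w hw
  have h1 : p '' interior A ∈ 𝓝 (p w) :=
    (hp _ isOpen_interior).mem_nhds (mem_image_of_mem p hw)
  obtain ⟨q, ⟨w', hw', rfl⟩, hq⟩ := exists_not_layer k n (p w) _ h1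
  exact hq (hA (interior_subset hw'))

theorem isOpenMap_zero : IsOpenMap (fun y : QkOmega k => y 0) :=
  isOpenMap_eval (X := fun _ : ℕ => Qk k) 0

/-- prepend finitely many coordinates -/
def prep {k : Cardinal.{u}} (v : QkOmega k) (N : ℕ) (y : QkOmega k) : QkOmega k :=
  fun i => if i < N then v i else y (i - N)

theorem prep_continuous (v : QkOmega k) (N : ℕ) : Continuous (prep v N) := by
  refine continuous_pi fun i => ?_
  by_cases h : i < N
  · simp only [prep, if_pos h]; exact continuous_const
  · simp only [prep, if_neg h]; exact continuous_apply (A := fun _ : ℕ => Qk k) (i - N)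

def unprep {k : Cardinal.{u}} (N : ℕ) (y : QkOmega k) : QkOmega k := fun i => y (i + N)

theorem unprep_continuous (N : ℕ) : Continuous (unprep (k := k) N) :=
  continuous_pi fun i => continuous_apply (A := fun _ : ℕ => Qk k) (i + N)

theorem unprep_prep (v : QkOmega k) (N : ℕ) : Function.LeftInverse (unprep N) (prep v N) := by
  intro y
  funext i
  simp [unprep, prep]

theorem prep_mem (v : QkOmega k) (s : Set (QkOmega k)) (hs : s ∈ 𝓝 v) :
    ∃ N, 0 < N ∧ ∀ y, prep v N y ∈ s := by
  obtain ⟨N, hN⟩ := (naQkOmega k).exists_sub hs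
  refine ⟨N + 1, Nat.succ_pos _, fun y => hN _ ?_⟩
  intro i hi
  have : prep v (N + 1) y i = v i := by
    simp [prep, show i < N + 1 by omega]
  rw [this]
  exact (naQk k).refl _ _

theorem prep_zero (v : QkOmega k) {N : ℕ} (h : 0 < N) (y : QkOmega k) : prep v N y 0 = v 0 := by
  simp [prep, h]

theorem exists_inj (hk : Cardinal.aleph0 ≤ k) : ∃ f : StarT k → QBase k, Function.Injective f := by
  suffices hle : Cardinal.mk (StarT k) ≤ Cardinal.mk (QBase k) by
    obtain ⟨f⟩ := (Cardinal.le_def _ _).1 hle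
    exact ⟨f, f.injective⟩
  have hQ : k ≤ Cardinal.mk (QBase k) := by
    have : Cardinal.mk (DiscT k) = k := Cardinal.mk_out k
    calc k = Cardinal.mk (DiscT k) := this.symm
      _ ≤ Cardinal.mk (QBase k) := Cardinal.mk_le_of_injective (qi_injective k)
  refine le_trans ?_ hQ
  by_cases h : k = Cardinal.aleph0
  · have : StarT k = ULift Bool := by simp [StarT, h]
    rw [this]
    refine le_trans ?_ hk
    exact Cardinal.mk_le_aleph0
  · have : StarT k = DiscT k := by simp [StarT, h]
    rw [this]
    exact (Cardinal.mk_out k).le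

open Classical in
/-- An `F_σ`-subset of `B*(k)` is a preimage of `Q(k)` under a continuous map. -/
theorem fsigma_reduction [Nonempty (DiscT k)] (A : Set (BaireStar k)) (hA : IsFsigmaSet A) :
    ∃ h : BaireStar k → (ℕ → QBase k), Continuous h ∧
      ∀ x, x ∈ A ↔ ∀ᶠ n in atTop, h x n = qz k := by
  obtain ⟨C, hC, rfl⟩ := hA
  let E := naBaireStar k
  let v : DiscT k := Classical.arbitrary _
  have hex : ∀ n x, ∃ m, n ≤ m ∨ ∃ y ∈ C m, E.e n x y := fun n x => ⟨n, Or.inl le_rfl⟩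
  let p : ℕ → BaireStar k → ℕ := fun n x => Nat.find (hex n x)
  have pmono : ∀ x, Monotone fun n => p n x := by
    intro x
    refine monotone_nat_of_le_succ fun n => ?_
    refine Nat.find_min' (hex n x) ?_
    rcases Nat.find_spec (hex (n + 1) x) with h | ⟨y, hy, h⟩
    · exact Or.inl ((Nat.le_succ n).trans h)
    · exact Or.inr ⟨y, hy, E.anti (Nat.le_succ n) h⟩
  have pcongr : ∀ n x y, E.e n x y → p n x = p n y := by
    intro n x y h
    apply Nat.find_congr'
    intro m
    refine or_congr Iff.rfl (exists_congr fun w => and_congr_right fun _ => ?_)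
    exact ⟨fun h' => E.trans (E.symm h) h', fun h' => E.trans h h'⟩
  refine ⟨fun x n => if p (n + 1) x = p n x then qz k else qi v, ?_, ?_⟩
  · refine continuous_pi fun n => ?_
    rw [continuous_iff_continuousAt]
    intro x
    refine ContinuousAt.congr (f := fun _ => if p (n + 1) x = p n x then qz k else qi v)
      continuousAt_const ?_
    filter_upwards [E.mem_nhds x (n + 1)] with y hy
    rw [pcongr _ _ _ hy, pcongr n x y (E.anti (Nat.le_succ n) hy)]
  · intro x
    have hiff : ∀ n, (if p (n + 1) x = p n x then qz k else qi v) = qz k ↔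
        p (n + 1) x = p n x := by
      intro n
      by_cases h : p (n + 1) x = p n x <;> simp [h, qi_ne]
    simp only [hiff]
    constructor
    · intro hx
      obtain ⟨m, hm⟩ := mem_iUnion.1 hx
      have hb : ∀ n, p n x ≤ m := fun n => Nat.find_min' (hex n x) (Or.inr ⟨x, hm, E.refl _ _⟩)
      obtain ⟨N, hN⟩ : ∃ N, ∀ n, N ≤ n → p n x = p N x := by
        have hfin : (range fun n => p n x).Finite :=
          (finite_Iic m).subset (by rintro _ ⟨n, rfl⟩; exact hb n)
        obtain ⟨q, ⟨N, rfl⟩, hq⟩ := hfin.exists_maximal (range_nonempty _)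
        exact ⟨N, fun n hn => le_antisymm (hq ⟨n, rfl⟩ (pmono x hn)) (pmono x hn)⟩
      filter_upwards [eventually_ge_atTop N] with n hn
      rw [hN n hn, hN (n + 1) (by omega)]
    · intro hx
      obtain ⟨N, hN⟩ := eventually_atTop.1 hx
      have hc : ∀ n, N ≤ n → p n x = p N x := by
        intro n hn
        induction n, hn using Nat.le_induction with
        | base => rfl
        | succ n hn ih => rw [hN n hn, ih]
      refine mem_iUnion.2 ⟨p N x, ?_⟩
      by_contra hxC
      obtain ⟨n, hn⟩ := E.exists_sub ((hC (p N x)).isOpen_compl.mem_nhds hxC)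
      have hbig : max (max n N) (p N x + 1) ≥ N := le_trans (le_max_right _ _) (le_max_left _ _)
      have h1 := hc _ hbig
      have h2 := Nat.find_spec (hex (max (max n N) (p N x + 1)) x)
      rw [show Nat.find (hex (max (max n N) (p N x + 1)) x) = p N x from h1] at h2
      rcases h2 with h2 | ⟨y, hy, h2⟩
      · have := le_max_right (max n N) (p N x + 1)
        omega
      · exact hn y (E.anti (le_trans (le_max_left _ _) (le_max_left _ _)) h2) hy

theorem closed_embed (hk : Cardinal.aleph0 ≤ k) [Nonempty (DiscT k)] (F : Set (BaireStar k))
    (hF : IsFsigmaDelta F) (x0 : BaireStar k) : ∃ g : ↥F → (ℕ ⊕ ℕ → Qk k), IsClosedEmbedding g := by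
  obtain ⟨A, hA, rfl⟩ := hF
  choose h hcont hh using fun n => fsigma_reduction k (A n) (hA n)
  obtain ⟨ι, hι⟩ := exists_inj k hk
  have : Nonempty (StarT k) := ⟨x0 0⟩
  let H : BaireStar k → (ℕ ⊕ ℕ → ℕ → QBase k) := fun x =>
    Sum.elim (fun i m => if m = 0 then ι (x i) else qz k) (fun n => h n x)
  have Hc : Continuous H := by
    refine continuous_pi fun j => ?_
    rcases j with i | n
    · refine continuous_pi fun m => ?_
      by_cases hm : m = 0
      · simp only [H, Sum.elim_inl, if_pos hm]
        exact continuous_of_discreteTopology.comp (continuous_apply (A := fun _ : ℕ => StarT k) i)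
      · simp only [H, Sum.elim_inl, if_neg hm]
        exact continuous_const
    · exact hcont n
  let Hi : (ℕ ⊕ ℕ → ℕ → QBase k) → BaireStar k := fun w i => Function.invFun ι (w (Sum.inl i) 0)
  have Hic : Continuous Hi := by
    refine continuous_pi fun i => ?_
    have h1 : Continuous fun w : ℕ ⊕ ℕ → ℕ → QBase k => w (Sum.inl i) 0 := by fun_prop
    exact (continuous_of_discreteTopology (f := Function.invFun ι)).comp h1
  have Hl : Function.LeftInverse Hi H := by
    intro x
    funext i
    simp [Hi, H, Function.leftInverse_invFun hι (x i)]
  have Hce : IsClosedEmbedding H := Hl.isClosedEmbedding Hic Hc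
  let cc : (ℕ ⊕ ℕ → Qk k) → (ℕ ⊕ ℕ → ℕ → QBase k) := fun w j => (w j).toFun
  have cce : IsEmbedding cc := IsEmbedding.piMap fun _ => Qk.isEmbedding k
  have Hmem : ∀ x, (x ∈ ⋂ n, A n) ↔ ∀ j, ∀ᶠ m in atTop, H x j m = qz k := by
    intro x
    rw [mem_iInter]
    constructor
    · intro hx j
      rcases j with i | n
      · filter_upwards [eventually_gt_atTop 0] with m hm
        simp [H, hm.ne']
      · exact (hh n x).1 (hx n)
    · intro hx n
      exact (hh n x).2 (hx (Sum.inr n))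
  let g : ↥(⋂ n, A n) → (ℕ ⊕ ℕ → Qk k) := fun x j => Qk.ofFun (H x.1 j) ((Hmem x.1).1 x.2 j)
  have hcg : cc ∘ g = H ∘ Subtype.val := rfl
  have hge : IsEmbedding (cc ∘ g) := by rw [hcg]; exact Hce.isEmbedding.comp IsEmbedding.subtypeVal
  have gc : Continuous g := by
    rw [cce.continuous_iff]; exact hge.continuous
  refine ⟨g, IsEmbedding.of_comp gc cce.continuous hge, ?_⟩
  have : range g = cc ⁻¹' range H := by
    ext w
    constructor
    · rintro ⟨x, rfl⟩; exact ⟨x.1, rfl⟩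
    · rintro ⟨x, hx⟩
      have hxA : x ∈ ⋂ n, A n := (Hmem x).2 fun j => by rw [hx]; exact (w j).2
      refine ⟨⟨x, hxA⟩, cce.injective ?_⟩
      exact hx
  rw [this]
  exact Hce.isClosed_range.preimage cce.continuous

theorem main_aux (hk : Cardinal.aleph0 ≤ k)
    (F : Set (BaireStar k)) (hF : IsFsigmaDelta F) (hne : F.Nonempty) :
    Nonempty ((↥F × QkOmega k) ≃ₜ QkOmega k) := by
  have hD : Nonempty (DiscT k) := by
    rw [← Cardinal.mk_ne_zero_iff]
    have h1 : Cardinal.mk (DiscT k) = k := Cardinal.mk_out k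
    rw [h1]
    exact (Cardinal.aleph0_pos.trans_le hk).ne'
  obtain ⟨x0, hx0⟩ := hne
  have : Nonempty ↥F := ⟨⟨x0, hx0⟩⟩
  obtain ⟨g0, hg0⟩ := closed_embed k hk F hF x0
  -- embedding of the product
  let e1 : (ℕ ⊕ ℕ → Qk k) ≃ₜ QkOmega k :=
    Homeomorph.piCongrLeft (Y := fun _ : ℕ => Qk k) Equiv.natSumNatEquivNat
  have hp : IsClosedEmbedding (Prod.map (e1 ∘ g0) (id : QkOmega k → QkOmega k)) :=
    (e1.isClosedEmbedding.comp hg0).prodMap IsClosedEmbedding.id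
  let e2 : (QkOmega k × QkOmega k) ≃ₜ (ℕ ⊕ ℕ → Qk k) :=
    (Homeomorph.sumArrowHomeomorphProdArrow (ι := ℕ) (ι' := ℕ) (X := Qk k)).symm
  have hG : IsClosedEmbedding (e1 ∘ e2 ∘ Prod.map (e1 ∘ g0) (id : QkOmega k → QkOmega k)) :=
    e1.isClosedEmbedding.comp (e2.isClosedEmbedding.comp hp)
  set G : ↥F × QkOmega k → QkOmega k :=
    e1 ∘ e2 ∘ Prod.map (e1 ∘ g0) (id : QkOmega k → QkOmega k)
  have hpe : ∀ v N, IsClosedEmbedding (prep (k := k) v N) := fun v N =>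
    (unprep_prep k v N).isClosedEmbedding (unprep_continuous k N) (prep_continuous k v N)
  have ho2 : IsOpenMap (fun x : ↥F × QkOmega k => x.2 0) :=
    (isOpenMap_zero k).comp isOpenMap_snd
  have hc0 : Continuous (fun y : QkOmega k => y 0) := continuous_apply (A := fun _ : ℕ => Qk k) 0
  refine homeo_of_embeddings
    (((naBaireStar k).induced Subtype.val IsInducing.subtypeVal).prod (naQkOmega k)) (naQkOmega k)
    (fun n => (fun x : ↥F × QkOmega k => x.2 0) ⁻¹' layer k n)
    (fun n => (isClosed_layer k n).preimage (hc0.comp continuous_snd))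
    (fun n => interior_layer k _ ho2 n _ Subset.rfl)
    (fun x => exists_layer k (x.2 0))
    (fun n => (fun y : QkOmega k => y 0) ⁻¹' layer k n)
    (fun n => (isClosed_layer k n).preimage hc0)
    (fun n => interior_layer k _ (isOpenMap_zero k) n _ Subset.rfl)
    (fun y => exists_layer k (y 0)) ?_ ?_
  · rintro V hV ⟨v, hv⟩
    obtain ⟨N, hN, hNV⟩ := prep_mem k v V (hV.mem_nhds hv)
    refine ⟨prep v N ∘ G, (hpe v N).comp hG, ?_, ?_⟩
    · rintro _ ⟨x, rfl⟩; exact hNV _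
    · obtain ⟨n, hn⟩ := exists_layer k (v 0)
      refine interior_layer k _ (isOpenMap_zero k) n _ ?_
      rintro _ ⟨x, rfl⟩
      show prep v N (G x) 0 ∈ layer k n
      rw [prep_zero k v hN]; exact hn
  · rintro V hV ⟨⟨f, v⟩, hv⟩
    have hV' : (fun y : QkOmega k => (f, y)) ⁻¹' V ∈ 𝓝 v :=
      (hV.preimage (Continuous.prodMk_right f)).mem_nhds hv
    obtain ⟨N, hN, hNV⟩ := prep_mem k v _ hV'
    refine ⟨fun y => (f, prep v N y), ?_, ?_, ?_⟩
    · have hl : Function.LeftInverse (fun x : ↥F × QkOmega k => unprep N x.2)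
          (fun y => (f, prep v N y)) := unprep_prep k v N
      exact hl.isClosedEmbedding ((unprep_continuous k N).comp continuous_snd)
        (continuous_const.prodMk (prep_continuous k v N))
    · rintro _ ⟨x, rfl⟩; exact hNV _
    · obtain ⟨n, hn⟩ := exists_layer k (v 0)
      refine interior_layer k _ ho2 n _ ?_
      rintro _ ⟨x, rfl⟩
      show prep v N x 0 ∈ layer k n
      rw [prep_zero k v hN]; exact hn

end Application

end

/-- Corollary `c-hko`: for a nonempty `F_σδ`-subset `F` of `B*(k)`,
`F × Q(k)^ω ≈ Q(k)^ω` and `F` embeds as a closed subset of `Q(k)^ω`. -/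
theorem stmt_10 (k : Cardinal.{u}) (hk : Cardinal.aleph0 ≤ k)
    (F : Set (BaireStar k)) (hF : IsFsigmaDelta F) (hne : F.Nonempty) :
    Nonempty ((↥F × QkOmega k) ≃ₜ QkOmega k) ∧
      ∃ C : Set (QkOmega k), IsClosed C ∧ Nonempty (↥F ≃ₜ ↥C) := by
  obtain ⟨e⟩ := main_aux k hk F hF hne
  refine ⟨⟨e⟩, ?_⟩
  let w : QkOmega k := Classical.arbitrary _
  have hl : Function.LeftInverse (fun x : ↥F × QkOmega k => x.1) (fun x => (x, w)) := fun _ => rfl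
  have hc : IsClosedEmbedding (fun x : ↥F => (x, w)) :=
    hl.isClosedEmbedding continuous_fst (Continuous.prodMk_left w)
  have he : IsClosedEmbedding (e ∘ fun x : ↥F => (x, w)) := e.isClosedEmbedding.comp hc
  exact ⟨_, he.isClosed_range, ⟨he.isEmbedding.toHomeomorph⟩⟩
end
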